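/- arXiv:2007.15301 — 9 statements merged into one kernel-verified Lean document; each statement's English description precedes it below -/
import Mathlib

section
/- Let β ∈ (0, 2), m ∈ ℕ, and let g : ℝ → ℝ be measurable with g(x) = 0 for x ≤ 0, and suppose there exist constants K > 0, α > 0 and κ ∈ ℝ with κ > −1/β and αβ > 2 such that |g(x)| ≤ K(x^κ·1_{[0,1)}(x) + x^{−α}·1_{[1,∞)}(x)) for all x ≥ 0. Then there exists a constant C > 0 such that for every integer i ≥ 1, ρ_i := ∫_ℝ |g(x) g(x + i)|^{β/2} dx ≤ C i^{−αβ/2}. -/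
open Set

/-- The function equal to `y ^ a` on `(0,1)`, to `y ^ (-b)` on `[1,∞)` and to `0` elsewhere is
integrable when `-1 < a` and `1 < b`. -/
lemma integrable_indicator_rpow_add_indicator_rpow {a b : ℝ} (ha : -1 < a) (hb : 1 < b) :
    MeasureTheory.Integrable (fun x : ℝ => (Ioo (0:ℝ) 1).indicator (fun y => y ^ a) x
      + (Ici (1:ℝ)).indicator (fun y => y ^ (-b)) x) := by
  refine MeasureTheory.Integrable.add ?_ ?_
  · rw [MeasureTheory.integrable_indicator_iff measurableSet_Ioo]
    exact (intervalIntegral.integrableOn_Ioo_rpow_iff one_pos).2 ha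
  · rw [MeasureTheory.integrable_indicator_iff measurableSet_Ici,
      integrableOn_Ici_iff_integrableOn_Ioi]
    exact integrableOn_Ioi_rpow_of_lt (by linarith) one_pos

/-- The pointwise bound on the kernel, raised to a nonnegative power. -/
lemma abs_rpow_le_of_abs_le_indicator {g : ℝ → ℝ} {K α κ s : ℝ} (hK : 0 ≤ K) (hs : 0 ≤ s)
    {x : ℝ} (hx : 0 < x)
    (h : |g x| ≤ K * ((Ico (0:ℝ) 1).indicator (fun y => y ^ κ) x
      + (Ici (1:ℝ)).indicator (fun y => y ^ (-α)) x)) :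
    |g x| ^ s ≤ K ^ s * ((Ioo (0:ℝ) 1).indicator (fun y => y ^ (κ * s)) x
      + (Ici (1:ℝ)).indicator (fun y => y ^ (-(α * s))) x) := by
  refine (Real.rpow_le_rpow (abs_nonneg _) h hs).trans_eq ?_
  rcases lt_or_ge x 1 with h1 | h1
  · have e1 : x ∈ Ico (0:ℝ) 1 := ⟨hx.le, h1⟩
    have e2 : x ∈ Ioo (0:ℝ) 1 := ⟨hx, h1⟩
    have e3 : x ∉ Ici (1:ℝ) := not_le.2 h1
    simp only [indicator_of_mem e1, indicator_of_mem e2, indicator_of_notMem e3, add_zero]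
    rw [Real.mul_rpow hK (by positivity), ← Real.rpow_mul hx.le]
  · have e1 : x ∉ Ico (0:ℝ) 1 := fun h => h.2.not_ge h1
    have e2 : x ∉ Ioo (0:ℝ) 1 := fun h => h.2.not_ge h1
    have e3 : x ∈ Ici (1:ℝ) := h1
    simp only [indicator_of_notMem e1, indicator_of_notMem e2, indicator_of_mem e3, zero_add]
    rw [Real.mul_rpow hK (by positivity), ← Real.rpow_mul hx.le, neg_mul]

/-- Lemma A.1(i) of the paper: for `β ∈ (0,2)` and a measurable kernel `g` vanishing on
`(−∞,0]` with `|g(x)| ≤ K(x^κ 1_{[0,1)}(x) + x^{−α} 1_{[1,∞)}(x))`, `κ > −1/β`, `αβ > 2`,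
there is `C > 0` with `ρ_i = ∫ |g(x) g(x+i)|^{β/2} dx ≤ C i^{−αβ/2}` for all integers `i ≥ 1`. -/
theorem stmt1 (β : ℝ) (hβ0 : 0 < β) (hβ2 : β < 2) (m : ℕ)
    (g : ℝ → ℝ) (hg_meas : Measurable g) (hg_zero : ∀ x ≤ (0:ℝ), g x = 0)
    (K α κ : ℝ) (hK : 0 < K) (hα : 0 < α) (hκ : -1 / β < κ) (hαβ : 2 < α * β)
    (hbound : ∀ x : ℝ, 0 ≤ x →
      |g x| ≤ K * ((Ico (0:ℝ) 1).indicator (fun y => y ^ κ) x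
        + (Ici (1:ℝ)).indicator (fun y => y ^ (-α)) x)) :
    ∃ C > 0, ∀ i : ℕ, 1 ≤ i →
      (∫ x : ℝ, |g x * g (x + (i : ℝ))| ^ (β / 2)) ≤ C * (i : ℝ) ^ (-(α * β) / 2) := by
  have hs : 0 < β / 2 := by linarith
  have hκs : -1 < κ * (β / 2) := by
    have := (div_lt_iff₀ hβ0).1 hκ
    linarith
  have hαs : 1 < α * (β / 2) := by linarith
  have hKs : 0 < K ^ (β / 2) := Real.rpow_pos_of_pos hK _
  set H : ℝ → ℝ := fun x => (Ioo (0:ℝ) 1).indicator (fun y => y ^ (κ * (β / 2))) x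
      + (Ici (1:ℝ)).indicator (fun y => y ^ (-(α * (β / 2)))) x with hH
  have hHint : MeasureTheory.Integrable H :=
    integrable_indicator_rpow_add_indicator_rpow hκs hαs
  have hH0 : ∀ x, 0 ≤ H x := fun x => add_nonneg
    (indicator_nonneg (fun y hy => Real.rpow_nonneg hy.1.le _) x)
    (indicator_nonneg (fun y hy => Real.rpow_nonneg (zero_le_one.trans hy) _) x)
  have hI : 0 ≤ ∫ x, H x := MeasureTheory.integral_nonneg hH0
  refine ⟨K ^ (β / 2) * K ^ (β / 2) * (∫ x, H x) + 1, by positivity, fun i hi => ?_⟩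
  have hi1 : (1:ℝ) ≤ i := by exact_mod_cast hi
  have hi0 : (0:ℝ) < i := by linarith
  set p : ℝ := (i : ℝ) ^ (-(α * β) / 2) with hp
  have hp0 : 0 < p := Real.rpow_pos_of_pos hi0 _
  have hle : ∀ x : ℝ, |g x * g (x + (i : ℝ))| ^ (β / 2)
      ≤ (K ^ (β / 2) * K ^ (β / 2) * p) * H x := by
    intro x
    rcases le_or_gt x 0 with hx | hx
    · rw [hg_zero x hx, zero_mul, abs_zero, Real.zero_rpow hs.ne']
      exact mul_nonneg (by positivity) (hH0 x)
    · have hxi : (1:ℝ) ≤ x + i := by linarith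
      have h1 : |g x| ^ (β / 2) ≤ K ^ (β / 2) * H x :=
        abs_rpow_le_of_abs_le_indicator hK.le hs.le hx (hbound x hx.le)
      have h2 : |g (x + i)| ^ (β / 2) ≤ K ^ (β / 2) * p := by
        refine (abs_rpow_le_of_abs_le_indicator hK.le hs.le (by linarith)
          (hbound (x + i) (by linarith))).trans ?_
        have e2 : x + i ∉ Ioo (0:ℝ) 1 := fun h => h.2.not_ge hxi
        have e3 : x + i ∈ Ici (1:ℝ) := hxi
        rw [indicator_of_notMem e2, indicator_of_mem e3, zero_add, hp,
          show -(α * β) / 2 = -(α * (β / 2)) by ring]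
        gcongr ?_ * ?_
        exact Real.rpow_le_rpow_of_nonpos hi0 (by linarith) (by linarith)
      rw [abs_mul, Real.mul_rpow (abs_nonneg _) (abs_nonneg _)]
      refine (mul_le_mul h1 h2 (by positivity) (mul_nonneg hKs.le (hH0 x))).trans_eq ?_
      ring
  calc (∫ x : ℝ, |g x * g (x + (i : ℝ))| ^ (β / 2))
      ≤ ∫ x, (K ^ (β / 2) * K ^ (β / 2) * p) * H x :=
        MeasureTheory.integral_mono_of_nonneg
          (Filter.Eventually.of_forall fun x => Real.rpow_nonneg (abs_nonneg _) _)
          (hHint.const_mul _) (Filter.Eventually.of_forall hle)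
    _ = (K ^ (β / 2) * K ^ (β / 2) * (∫ x, H x)) * p := by
        rw [MeasureTheory.integral_const_mul]; ring
    _ ≤ (K ^ (β / 2) * K ^ (β / 2) * (∫ x, H x) + 1) * p := by
        gcongr
        linarith
end

section
/- Let (Y^n_u)_{u ∈ ℝ_+^m} (n ∈ ℕ) and (Y_u)_{u ∈ ℝ_+^m} be continuous random fields (on a common probability space) converging in finite-dimensional distributions: Y^n → Y, i.e. for every finite collection u^{(1)}, …, u^{(r)} ∈ ℝ_+^m the random vectors (Y^n_{u^{(1)}}, …, Y^n_{u^{(r)}}) converge in distribution to (Y_{u^{(1)}}, …, Y_{u^{(r)}}). Assume ∫_{ℝ_+^m} E[|Y^n_u|] du < ∞ for all n and ∫_{ℝ_+^m} E[|Y_u|] du < ∞. For k, ℓ, n ∈ ℕ set X_{n,k,ℓ} = ∫_{[0,ℓ]^m} Y^n_{⌊uk⌋/k} du (with ⌊uk⌋/k taken coordinatewise) and X_{n,ℓ} = ∫_{[0,ℓ]^m} Y^n_u du. Suppose that (a) for every i ∈ {0, …, m−1}, lim_{ℓ→∞} limsup_{n→∞} ∫_{ℝ_+^{m−1−i}} ∫_ℓ^∞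 ∫_{ℝ_+^i} E[|Y^n_u|] du = 0, and (b) for all ε, ℓ > 0, lim_{k→∞} limsup_{n→∞} P(|X_{n,k,ℓ} − X_{n,ℓ}| > ε) = 0. Then ∫_{ℝ_+^m} Y^n_u du converges in distribution to ∫_{ℝ_+^m} Y_u du as n → ∞. -/
open MeasureTheory Filter BoundedContinuousFunction

/-- A bounded Lipschitz function separates the expectations of two random variables by at most
its Lipschitz constant times `ε`, up to the probability that they differ by more than `ε`. -/
lemma abs_integral_comp_sub_le_of_lipschitzWith {Ω : Type*} [MeasurableSpace Ω] {P : Measure Ω}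
    [IsProbabilityMeasure P] {F : ℝ → ℝ} {M : ℝ} {L : NNReal}
    (hM : ∀ x y, dist (F x) (F y) ≤ M) (hL : LipschitzWith L F)
    {U V : Ω → ℝ} (hU : Measurable U) (hV : Measurable V) {ε : ℝ} (hε : 0 ≤ ε) :
    |∫ ω, F (U ω) ∂P - ∫ ω, F (V ω) ∂P| ≤ L * ε + M * P.real {ω | ε < |U ω - V ω|} := by
  have hFm : Measurable F := hL.continuous.measurable
  have hM0 : 0 ≤ M := dist_nonneg.trans (hM 0 0)
  have hint {T : Ω → ℝ} (hT : Measurable T) : Integrable (fun ω ↦ F (T ω)) P := by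
    refine Integrable.of_bound (hFm.comp hT).aestronglyMeasurable (‖F 0‖ + M)
      (ae_of_all _ fun a ↦ ?_)
    rw [← sub_le_iff_le_add']
    exact (abs_sub_abs_le_abs_sub _ _).trans (hM _ _)
  have hS : MeasurableSet {ω | ε < |U ω - V ω|} :=
    measurableSet_lt measurable_const (hU.sub hV).abs
  rw [← integral_sub (hint hU) (hint hV), ← Real.norm_eq_abs]
  have hind : Integrable (Set.indicator {ω | ε < |U ω - V ω|} fun _ ↦ M) P :=
    (integrable_const M).indicator hS
  calc ‖∫ ω, F (U ω) - F (V ω) ∂P‖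
      ≤ ∫ ω, (L * ε + Set.indicator {ω | ε < |U ω - V ω|} (fun _ ↦ M) ω) ∂P := by
        refine norm_integral_le_of_norm_le ((integrable_const _).add hind) (ae_of_all _ fun ω ↦ ?_)
        by_cases h : ε < |U ω - V ω|
        · rw [Set.indicator_of_mem (by exact h)]
          have := hM (U ω) (V ω)
          rw [dist_eq_norm] at this
          have : 0 ≤ (L : ℝ) * ε := by positivity
          linarith
        · rw [Set.indicator_of_notMem (by exact h), add_zero]
          exact hL.norm_sub_le_of_le (not_lt.1 h)
    _ = L * ε + M * P.real {ω | ε < |U ω - V ω|} := by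
        rw [integral_add (integrable_const _) hind, integral_indicator_const _ hS]
        simp [mul_comm]

/-- Convergence of expectations of bounded continuous functions may be tested on bounded
Lipschitz functions. -/
lemma tendsto_integral_comp_of_forall_lipschitz {Ω : Type*} [MeasurableSpace Ω] {P : Measure Ω}
    [IsProbabilityMeasure P] {X : ℕ → Ω → ℝ} {W : Ω → ℝ}
    (hX : ∀ n, Measurable (X n)) (hW : Measurable W)
    (h : ∀ F : ℝ → ℝ, (∃ M, ∀ x y, dist (F x) (F y) ≤ M) → (∃ L, LipschitzWith L F) →
      Tendsto (fun n ↦ ∫ ω, F (X n ω) ∂P) atTop (nhds (∫ ω, F (W ω) ∂P)))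
    (f : ℝ →ᵇ ℝ) :
    Tendsto (fun n ↦ ∫ ω, f (X n ω) ∂P) atTop (nhds (∫ ω, f (W ω) ∂P)) := by
  let μs : ℕ → ProbabilityMeasure ℝ := fun n ↦
    ⟨P.map (X n), Measure.isProbabilityMeasure_map (hX n).aemeasurable⟩
  let μ : ProbabilityMeasure ℝ := ⟨P.map W, Measure.isProbabilityMeasure_map hW.aemeasurable⟩
  have key {T : Ω → ℝ} (hT : Measurable T) {F : ℝ → ℝ} (hF : Continuous F) :
      ∫ x, F x ∂(P.map T) = ∫ ω, F (T ω) ∂P :=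
    integral_map hT.aemeasurable hF.aestronglyMeasurable
  have hμ : Tendsto μs atTop (nhds μ) := by
    rw [tendsto_iff_forall_lipschitz_integral_tendsto]
    rintro F hM ⟨L, hL⟩
    simpa only [μs, μ, ProbabilityMeasure.coe_mk, key (hX _) hL.continuous,
      key hW hL.continuous] using h F hM ⟨L, hL⟩
  have := ProbabilityMeasure.tendsto_iff_forall_integral_tendsto.1 hμ f
  simpa only [μs, μ, ProbabilityMeasure.coe_mk, key (hX _) f.continuous,
    key hW f.continuous] using this

/-- Convergence in distribution through approximations: if `A k n → V k` in distribution as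
`n → ∞` for all large `k`, `V k → W` in distribution, and `A k n` is close to `X n` in
probability, then `X n → W` in distribution. -/
lemma tendsto_integral_comp_of_approx {Ω : Type*} [MeasurableSpace Ω] {P : Measure Ω}
    [IsProbabilityMeasure P] {A : ℕ → ℕ → Ω → ℝ} {X V : ℕ → Ω → ℝ} {W : Ω → ℝ}
    (hA : ∀ k n, Measurable (A k n)) (hX : ∀ n, Measurable (X n)) (hW : Measurable W)
    (hAV : ∀ᶠ k in atTop, ∀ f : ℝ →ᵇ ℝ,
      Tendsto (fun n ↦ ∫ ω, f (A k n ω) ∂P) atTop (nhds (∫ ω, f (V k ω) ∂P)))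
    (hVW : ∀ f : ℝ →ᵇ ℝ,
      Tendsto (fun k ↦ ∫ ω, f (V k ω) ∂P) atTop (nhds (∫ ω, f (W ω) ∂P)))
    (hAX : ∀ ε : ℝ, 0 < ε → Tendsto
      (fun k ↦ limsup (fun n ↦ P {ω | ε < |A k n ω - X n ω|}) atTop) atTop (nhds 0))
    (f : ℝ →ᵇ ℝ) :
    Tendsto (fun n ↦ ∫ ω, f (X n ω) ∂P) atTop (nhds (∫ ω, f (W ω) ∂P)) := by
  refine tendsto_integral_comp_of_forall_lipschitz hX hW ?_ f
  rintro F ⟨M, hM⟩ ⟨L, hL⟩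
  have hM0 : 0 ≤ M := dist_nonneg.trans (hM 0 0)
  let g : ℝ →ᵇ ℝ := ⟨⟨F, hL.continuous⟩, M, hM⟩
  rw [Metric.tendsto_atTop']
  intro ε hε
  let δ : ℝ := ε / (4 * (L + 1))
  let η : ℝ := ε / (4 * (M + 1))
  have hδ : 0 < δ := by positivity
  have hη : 0 < η := by positivity
  have hLδ : L * δ ≤ ε / 4 := by
    have : (L + 1) * δ = ε / 4 := by simp only [δ]; field_simp
    linarith
  have hMη : M * η ≤ ε / 4 := by
    have : (M + 1) * η = ε / 4 := by simp only [η]; field_simp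
    linarith
  obtain ⟨k, hk1, hk2, hk3⟩ := (hAV.and (((Metric.tendsto_nhds.1 (hVW g)) (ε / 4)
    (by positivity)).and ((hAX δ hδ).eventually_lt_const (ENNReal.ofReal_pos.2 hη)))).exists
  suffices h : ∀ᶠ n in atTop, dist (∫ ω, F (X n ω) ∂P) (∫ ω, F (W ω) ∂P) < ε by
    obtain ⟨N, hN⟩ := eventually_atTop.1 h
    exact ⟨N, fun n hn ↦ hN n hn.le⟩
  filter_upwards [(Metric.tendsto_nhds.1 (hk1 g)) (ε / 4) (by positivity),
    eventually_lt_of_limsup_lt hk3] with n hn1 hn2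
  have hn3 : P.real {ω | δ < |A k n ω - X n ω|} ≤ η :=
    ENNReal.toReal_le_of_le_ofReal hη.le hn2.le
  have hn4 := abs_integral_comp_sub_le_of_lipschitzWith (P := P) hM hL (hA k n) (hX n) hδ.le
  have hn5 := mul_le_mul_of_nonneg_left hn3 hM0
  change dist (∫ ω, F (A k n ω) ∂P) (∫ ω, F (V k ω) ∂P) < _ at hn1
  change dist (∫ ω, F (V k ω) ∂P) (∫ ω, F (W ω) ∂P) < _ at hk2
  rw [Real.dist_eq, abs_lt] at *
  rw [abs_le] at hn4
  constructor <;> linarith [hn1.1, hn1.2, hk2.1, hk2.2, hn4.1, hn4.2]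

/-- Almost sure convergence implies convergence in distribution. -/
lemma tendsto_integral_comp_of_ae_tendsto {Ω : Type*} [MeasurableSpace Ω] {P : Measure Ω}
    [IsProbabilityMeasure P] {X : ℕ → Ω → ℝ} {W : Ω → ℝ} (hX : ∀ n, Measurable (X n))
    (h : ∀ᵐ ω ∂P, Tendsto (fun n ↦ X n ω) atTop (nhds (W ω))) (f : ℝ →ᵇ ℝ) :
    Tendsto (fun n ↦ ∫ ω, f (X n ω) ∂P) atTop (nhds (∫ ω, f (W ω) ∂P)) := by
  refine tendsto_integral_of_dominated_convergence (fun _ ↦ ‖f‖)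
    (fun n ↦ (f.continuous.measurable.comp (hX n)).aestronglyMeasurable) (integrable_const _)
    (fun n ↦ ae_of_all _ fun ω ↦ f.norm_coe_le_norm _) ?_
  filter_upwards [h] with ω hω using (f.continuous.tendsto _).comp hω

/-- The integral of `F ∘ g` over a set of finite measure on which `g` takes finitely many values
is a finite linear combination of values of `F`. -/
lemma setIntegral_comp_eq_sum_of_mapsTo_finset {α β : Type*} [MeasurableSpace α]
    [MeasurableSpace β] [MeasurableSingletonClass β] {μ : Measure α} {B : Set α}
    (hB : MeasurableSet B) (hμB : μ B ≠ ⊤) {g : α → β} (hg : Measurable g) {S : Finset β}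
    (hgS : ∀ a ∈ B, g a ∈ S) (F : β → ℝ) :
    ∫ a in B, F (g a) ∂μ = ∑ v ∈ S, μ.real (g ⁻¹' {v} ∩ B) * F v := by
  classical
  have hm (v : β) : MeasurableSet (g ⁻¹' {v}) := hg (measurableSet_singleton v)
  have : IsFiniteMeasure (μ.restrict B) := ⟨by simpa using hμB.lt_top⟩
  calc ∫ a in B, F (g a) ∂μ
      = ∫ a in B, ∑ v ∈ S, (g ⁻¹' {v}).indicator (fun _ ↦ F v) a ∂μ := by
        refine setIntegral_congr_fun hB fun a ha ↦ ?_
        simp [Set.indicator_apply, hgS a ha]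
    _ = _ := by
        rw [integral_finsetSum _ fun v _ ↦ (integrable_const _).indicator (hm v)]
        refine Finset.sum_congr rfl fun v _ ↦ ?_
        rw [integral_indicator_const _ (hm v), measureReal_restrict_apply (hm v), smul_eq_mul]

/-- The rounding of `u` down to the grid of mesh `1 / k`. -/
noncomputable def gridFloor {m : ℕ} (k : ℕ) (u : Fin m → ℝ) : Fin m → ℝ :=
  fun i ↦ ((⌊u i * (k : ℝ)⌋ : ℤ) : ℝ) / (k : ℝ)

lemma measurable_gridFloor {m : ℕ} (k : ℕ) : Measurable (gridFloor (m := m) k) := by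
  refine measurable_pi_lambda _ fun i ↦ ?_
  have : Measurable fun u : Fin m → ℝ ↦ ⌊u i * (k : ℝ)⌋ :=
    ((measurable_pi_apply i).mul_const _).floor
  exact ((measurable_from_top (f := fun z : ℤ ↦ (z : ℝ))).comp this).div_const _

lemma gridFloor_mem_Icc {m : ℕ} (k : ℕ) {b u : Fin m → ℝ} (hu : u ∈ Set.Icc 0 b) :
    gridFloor k u ∈ Set.Icc 0 b := by
  have h0 (i) : 0 ≤ u i := hu.1 i
  refine ⟨fun i ↦ ?_, fun i ↦ ?_⟩
  · have : (0 : ℤ) ≤ ⌊u i * (k : ℝ)⌋ := Int.floor_nonneg.2 (mul_nonneg (h0 i) (by positivity))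
    exact div_nonneg (Int.cast_nonneg this) (by positivity)
  · exact (div_le_of_le_mul₀ (by positivity) (h0 i) (Int.floor_le _)).trans (hu.2 i)

lemma tendsto_gridFloor {m : ℕ} (u : Fin m → ℝ) :
    Tendsto (fun k ↦ gridFloor k u) atTop (nhds u) := by
  refine tendsto_pi_nhds.2 fun i ↦ ?_
  have h : Tendsto (fun k : ℕ ↦ u i - 1 / (k : ℝ)) atTop (nhds (u i)) := by
    simpa using tendsto_const_nhds.sub (tendsto_one_div_atTop_nhds_zero_nat (𝕜 := ℝ))
  refine tendsto_of_tendsto_of_tendsto_of_le_of_le' h tendsto_const_nhds ?_ ?_ <;>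
    filter_upwards [eventually_gt_atTop 0] with k hk <;>
    have hk' : (0 : ℝ) < k := Nat.cast_pos.2 hk
  · rw [gridFloor, le_div_iff₀ hk', sub_mul, one_div_mul_cancel hk'.ne']
    exact (Int.sub_one_lt_floor _).le
  · exact (div_le_iff₀ hk').2 (Int.floor_le _)

lemma finite_gridFloor_image_Icc {m : ℕ} (k : ℕ) (b : Fin m → ℝ) :
    (gridFloor k '' Set.Icc 0 b).Finite := by
  refine ((Set.finite_Icc (0 : Fin m → ℤ) fun i ↦ ⌊b i * (k : ℝ)⌋).image
    fun z i ↦ (z i : ℝ) / (k : ℝ)).subset ?_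
  rintro _ ⟨u, hu, rfl⟩
  refine ⟨fun i ↦ ⌊u i * (k : ℝ)⌋, ⟨fun i ↦ ?_, fun i ↦ ?_⟩, rfl⟩
  · exact Int.floor_nonneg.2 (mul_nonneg (hu.1 i) (by positivity))
  · exact Int.floor_le_floor (mul_le_mul_of_nonneg_right (hu.2 i) (by positivity))

/-- Riemann sums of a continuous function on a box converge to its integral. -/
lemma tendsto_setIntegral_comp_gridFloor {m : ℕ} {F : (Fin m → ℝ) → ℝ} (hF : Continuous F)
    (b : Fin m → ℝ) :
    Tendsto (fun k ↦ ∫ u in Set.Icc 0 b, F (gridFloor k u)) atTop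
      (nhds (∫ u in Set.Icc 0 b, F u)) := by
  obtain ⟨C, hC⟩ := (isCompact_Icc (a := 0) (b := b)).exists_bound_of_continuousOn
    hF.continuousOn
  refine tendsto_integral_of_dominated_convergence (fun _ ↦ C)
    (fun k ↦ (hF.measurable.comp (measurable_gridFloor k)).aestronglyMeasurable)
    (integrableOn_const isCompact_Icc.measure_lt_top.ne) (fun k ↦ ?_)
    (ae_of_all _ fun u ↦ (hF.tendsto u).comp (tendsto_gridFloor u))
  filter_upwards [ae_restrict_mem measurableSet_Icc] with u hu
  exact hC _ (gridFloor_mem_Icc k hu)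

/-- Restricting integrals of an integrable random field to a measurable subset changes them in
mean by at most the mean mass of the field outside of it. -/
lemma lintegral_abs_setIntegral_sub_le {Ω α : Type*} [MeasurableSpace Ω] [MeasurableSpace α]
    {P : Measure Ω} [SFinite P] {μ : Measure α} [SFinite μ] {X : Ω → α → ℝ}
    (hX : Measurable (Function.uncurry X)) {B Q : Set α} (hB : MeasurableSet B)
    (hBQ : B ⊆ Q)
    (hint : ∀ᵐ ω ∂P, IntegrableOn (X ω) Q μ) :
    ∫⁻ ω, ENNReal.ofReal |∫ u in B, X ω u ∂μ - ∫ u in Q, X ω u ∂μ| ∂P ≤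
      ∫⁻ u in Q \ B, ∫⁻ ω, ENNReal.ofReal |X ω u| ∂P ∂μ := by
  rw [lintegral_lintegral_swap (by
    exact (hX.comp measurable_swap).abs.ennreal_ofReal.aemeasurable)]
  refine lintegral_mono_ae ?_
  filter_upwards [hint] with ω hω
  rw [← neg_sub, abs_neg, ← setIntegral_sdiff hB hω hBQ, ← Real.norm_eq_abs, ofReal_norm]
  refine (enorm_integral_le_lintegral_enorm _).trans_eq ?_
  simp_rw [← Real.norm_eq_abs, ofReal_norm]

/-- A random field with integrable mean absolute value has almost surely integrable paths. -/
lemma ae_integrableOn_of_lintegral_lt_top {Ω α : Type*} [MeasurableSpace Ω] [MeasurableSpace α]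
    {P : Measure Ω} [SFinite P] {μ : Measure α} [SFinite μ] {X : Ω → α → ℝ}
    (hX : Measurable (Function.uncurry X)) {Q : Set α}
    (h : ∫⁻ u in Q, ∫⁻ ω, ENNReal.ofReal |X ω u| ∂P ∂μ < ⊤) :
    ∀ᵐ ω ∂P, IntegrableOn (X ω) Q μ := by
  rw [lintegral_lintegral_swap (by
    exact (hX.comp measurable_swap).abs.ennreal_ofReal.aemeasurable)] at h
  have hm : Measurable fun ω ↦ ∫⁻ u in Q, ENNReal.ofReal |X ω u| ∂μ :=
    hX.abs.ennreal_ofReal.lintegral_prod_right'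
  filter_upwards [ae_lt_top hm h.ne] with ω hω
  refine ⟨(hX.comp measurable_prodMk_left).aestronglyMeasurable, ?_⟩
  simpa only [HasFiniteIntegral, ← ofReal_norm, Real.norm_eq_abs] using hω

/-- Lemma A.2 of the paper: convergence of integral functionals of random fields.
If the continuous random fields `Y^n` converge to `Y` in finite-dimensional
distributions on `ℝ_+^m` (tested against bounded continuous functions), all fields
are integrable in the sense `∫_{ℝ_+^m} E|Y^n_u| du < ∞`, the tails
`∫_{ℝ_+^{m−1−i}} ∫_ℓ^∞ ∫_{ℝ_+^i} E|Y^n_u| du` vanish (as `ℓ → ∞`, uniformly in `n`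
in the `limsup` sense), and the grid approximations
`X_{n,k,ℓ} = ∫_{[0,ℓ]^m} Y^n_{⌊uk⌋/k} du` approximate `X_{n,ℓ} = ∫_{[0,ℓ]^m} Y^n_u du`
in probability (as `k → ∞`, uniformly in `n` in the `limsup` sense), then
`∫_{ℝ_+^m} Y^n_u du → ∫_{ℝ_+^m} Y_u du` in distribution. -/
theorem stmt3 {Ω : Type*} [MeasurableSpace Ω] (P : Measure Ω) [IsProbabilityMeasure P]
    (m : ℕ) (hm : 1 ≤ m)
    (Y : ℕ → Ω → (Fin m → ℝ) → ℝ) (Z : Ω → (Fin m → ℝ) → ℝ)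
    (hYmeas : ∀ n, Measurable (Function.uncurry (Y n)))
    (hZmeas : Measurable (Function.uncurry Z))
    (hYcont : ∀ n ω, Continuous (Y n ω))
    (hZcont : ∀ ω, Continuous (Z ω))
    (Q : Set (Fin m → ℝ)) (hQ : Q = {u | ∀ i, 0 ≤ u i})
    (hfidi : ∀ (r : ℕ) (u : Fin r → (Fin m → ℝ)), (∀ j, u j ∈ Q) →
      ∀ f : (Fin r → ℝ) →ᵇ ℝ,
        Tendsto (fun n => ∫ ω, f (fun j => Y n ω (u j)) ∂P) atTop
          (nhds (∫ ω, f (fun j => Z ω (u j)) ∂P)))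
    (hInt : ∀ n, (∫⁻ u in Q, ∫⁻ ω, ENNReal.ofReal |Y n ω u| ∂P) < ⊤)
    (hIntZ : (∫⁻ u in Q, ∫⁻ ω, ENNReal.ofReal |Z ω u| ∂P) < ⊤)
    (htail : ∀ i : Fin m,
      Tendsto (fun ℓ : ℕ =>
          Filter.limsup (fun n =>
            ∫⁻ u in {u ∈ Q | (ℓ : ℝ) < u i}, ∫⁻ ω, ENNReal.ofReal |Y n ω u| ∂P) atTop)
        atTop (nhds 0))
    (happrox : ∀ ε : ℝ, 0 < ε → ∀ ℓ : ℕ, 0 < ℓ →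
      Tendsto (fun k : ℕ =>
          Filter.limsup (fun n =>
            P {ω | ε < |(∫ u in Set.Icc (0 : Fin m → ℝ) (fun _ => (ℓ : ℝ)),
                  Y n ω (fun i => ((⌊u i * (k : ℝ)⌋ : ℤ) : ℝ) / (k : ℝ)))
                - ∫ u in Set.Icc (0 : Fin m → ℝ) (fun _ => (ℓ : ℝ)), Y n ω u|}) atTop)
        atTop (nhds 0)) :
    ∀ f : ℝ →ᵇ ℝ,
      Tendsto (fun n => ∫ ω, f (∫ u in Q, Y n ω u) ∂P) atTop
        (nhds (∫ ω, f (∫ u in Q, Z ω u) ∂P)) := by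
  subst hQ
  let B : ℕ → Set (Fin m → ℝ) := fun ℓ ↦ Set.Icc 0 fun _ ↦ (ℓ : ℝ)
  have hBm (ℓ) : MeasurableSet (B ℓ) := measurableSet_Icc
  have hBQ (ℓ) : B ℓ ⊆ {u | ∀ i, 0 ≤ u i} := fun u hu ↦ hu.1
  have hmeas {X : Ω → (Fin m → ℝ) → ℝ} (hX : Measurable (Function.uncurry X))
      (S : Set (Fin m → ℝ)) : Measurable fun ω ↦ ∫ u in S, X ω u :=
    hX.stronglyMeasurable.integral_prod_right.measurable
  have hmeas' {X : Ω → (Fin m → ℝ) → ℝ} (hX : Measurable (Function.uncurry X)) (k : ℕ)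
      (S : Set (Fin m → ℝ)) : Measurable fun ω ↦ ∫ u in S, X ω (gridFloor k u) :=
    hmeas (X := fun ω u ↦ X ω (gridFloor k u))
      (hX.comp (measurable_fst.prodMk ((measurable_gridFloor k).comp measurable_snd))) S
  have hgrid (k ℓ : ℕ) (f : ℝ →ᵇ ℝ) :
      Tendsto (fun n ↦ ∫ ω, f (∫ u in B ℓ, Y n ω (gridFloor k u)) ∂P) atTop
        (nhds (∫ ω, f (∫ u in B ℓ, Z ω (gridFloor k u)) ∂P)) := by
    let S := (finite_gridFloor_image_Icc k fun _ : Fin m ↦ (ℓ : ℝ)).toFinset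
    have hS {u} (hu : u ∈ B ℓ) : gridFloor k u ∈ S :=
      (Set.Finite.mem_toFinset _).2 ⟨u, hu, rfl⟩
    have hSQ {v} (hv : v ∈ S) : ∀ i, 0 ≤ v i := by
      obtain ⟨u, hu, rfl⟩ := (Set.Finite.mem_toFinset _).1 hv
      exact (gridFloor_mem_Icc k hu).1
    let c : (Fin m → ℝ) → ℝ := fun v ↦ volume.real (gridFloor k ⁻¹' {v} ∩ B ℓ)
    let e := S.equivFin
    have hsum (F : (Fin m → ℝ) → ℝ) : ∫ u in B ℓ, F (gridFloor k u) =
        ∑ j, c (e.symm j) * F (e.symm j) := by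
      rw [setIntegral_comp_eq_sum_of_mapsTo_finset (hBm ℓ) isCompact_Icc.measure_lt_top.ne
        (measurable_gridFloor k) (fun _ ↦ hS), ← Finset.sum_coe_sort,
        ← Equiv.sum_comp e.symm]
    let φ : C(Fin S.card → ℝ, ℝ) := ⟨fun x ↦ ∑ j, c (e.symm j) * x j, by fun_prop⟩
    simpa only [hsum] using! hfidi S.card (fun j ↦ e.symm j) (fun j ↦ hSQ (e.symm j).2)
      (f.compContinuous φ)
  have hbox {ℓ : ℕ} (hℓ : 0 < ℓ) (f : ℝ →ᵇ ℝ) :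
      Tendsto (fun n ↦ ∫ ω, f (∫ u in B ℓ, Y n ω u) ∂P) atTop
        (nhds (∫ ω, f (∫ u in B ℓ, Z ω u) ∂P)) :=
    tendsto_integral_comp_of_approx (fun k n ↦ hmeas' (hYmeas n) k (B ℓ))
      (fun n ↦ hmeas (hYmeas n) _) (hmeas hZmeas _) (.of_forall fun k ↦ hgrid k ℓ)
      (tendsto_integral_comp_of_ae_tendsto (fun k ↦ hmeas' hZmeas k _)
        (ae_of_all _ fun ω ↦ tendsto_setIntegral_comp_gridFloor (hZcont ω) _))
      (fun ε hε ↦ happrox ε hε ℓ hℓ) f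
  refine tendsto_integral_comp_of_approx (A := fun ℓ n ω ↦ ∫ u in B ℓ, Y n ω u)
    (fun ℓ n ↦ hmeas (hYmeas n) _) (fun n ↦ hmeas (hYmeas n) _) (hmeas hZmeas _)
    ((eventually_gt_atTop 0).mono fun ℓ hℓ ↦ hbox hℓ)
    (tendsto_integral_comp_of_ae_tendsto (fun ℓ ↦ hmeas hZmeas (B ℓ)) ?_) ?_
  · have hU : ⋃ ℓ, B ℓ = {u | ∀ i, 0 ≤ u i} := by
      refine (Set.iUnion_subset hBQ).antisymm fun u hu ↦ ?_
      obtain ⟨ℓ, hℓ⟩ := exists_nat_ge ‖u‖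
      exact Set.mem_iUnion.2 ⟨ℓ, hu, fun i ↦
        ((Real.le_norm_self _).trans (norm_le_pi_norm u i)).trans hℓ⟩
    have hmono : Monotone B := fun a b hab ↦
      Set.Icc_subset_Icc_right fun _ ↦ Nat.cast_le.2 hab
    filter_upwards [ae_integrableOn_of_lintegral_lt_top hZmeas hIntZ] with ω hω
    rw [← hU] at hω ⊢
    exact tendsto_setIntegral_of_monotone hBm hmono hω
  · intro ε hε
    have hε' : ENNReal.ofReal ε ≠ 0 := (ENNReal.ofReal_pos.2 hε).ne'
    let t : Fin m → ℕ → ℕ → ENNReal := fun i ℓ n ↦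
      ∫⁻ u in {u ∈ {u | ∀ i, 0 ≤ u i} | (ℓ : ℝ) < u i}, ∫⁻ ω, ENNReal.ofReal |Y n ω u| ∂P
    have hprob (ℓ n : ℕ) :
        P {ω | ε < |(∫ u in B ℓ, Y n ω u) - ∫ u in {u | ∀ i, 0 ≤ u i}, Y n ω u|} ≤
          (∑ i, t i ℓ n) / ENNReal.ofReal ε := by
      have hsub : {u : Fin m → ℝ | ∀ i, 0 ≤ u i} \ B ℓ ⊆
          ⋃ i, {u ∈ {u | ∀ i, 0 ≤ u i} | (ℓ : ℝ) < u i} := by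
        rintro u ⟨hu, huB⟩
        by_contra! h
        rw [Set.mem_iUnion, not_exists] at h
        exact huB ⟨hu, fun i ↦ not_lt.1 fun hi ↦ h i ⟨hu, hi⟩⟩
      calc _ ≤ P {ω | ENNReal.ofReal ε ≤ ENNReal.ofReal
              |(∫ u in B ℓ, Y n ω u) - ∫ u in {u | ∀ i, 0 ≤ u i}, Y n ω u|} :=
            measure_mono fun ω hω ↦ ENNReal.ofReal_le_ofReal (le_of_lt hω)
        _ ≤ (∫⁻ ω, ENNReal.ofReal
              |(∫ u in B ℓ, Y n ω u) - ∫ u in {u | ∀ i, 0 ≤ u i}, Y n ω u| ∂P) /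
                ENNReal.ofReal ε :=
            meas_ge_le_lintegral_div
              ((hmeas (hYmeas n) _).sub (hmeas (hYmeas n) _)).abs.ennreal_ofReal.aemeasurable
              hε' ENNReal.ofReal_ne_top
        _ ≤ (∑ i, t i ℓ n) / ENNReal.ofReal ε := by
            gcongr
            refine (lintegral_abs_setIntegral_sub_le (hYmeas n) (hBm ℓ) (hBQ ℓ)
              (ae_integrableOn_of_lintegral_lt_top (hYmeas n) (hInt n))).trans ?_
            refine (lintegral_mono_set hsub).trans ?_
            exact (lintegral_iUnion_le _ _).trans_eq (tsum_fintype _)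
    rw [ENNReal.tendsto_nhds_zero]
    intro δ hδ
    have hm' : (m : ENNReal) ≠ 0 := Nat.cast_ne_zero.2 (by lia)
    have hη : 0 < δ * ENNReal.ofReal ε / m :=
      ENNReal.div_pos (mul_ne_zero hδ.ne' hε') (ENNReal.natCast_ne_top m)
    filter_upwards [eventually_all.2 fun i ↦ (htail i).eventually_lt_const hη] with ℓ hℓ
    refine limsup_le_of_le (by isBoundedDefault) ?_
    filter_upwards [eventually_all.2 fun i ↦ eventually_lt_of_limsup_lt (hℓ i)] with n hn
    refine (hprob ℓ n).trans (ENNReal.div_le_of_le_mul ?_)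
    calc ∑ i, t i ℓ n ≤ ∑ _i : Fin m, δ * ENNReal.ofReal ε / m :=
          Finset.sum_le_sum fun i _ ↦ (hn i).le
      _ = δ * ENNReal.ofReal ε := by
          rw [Finset.sum_const, Finset.card_univ, Fintype.card_fin, nsmul_eq_mul,
            ENNReal.mul_div_cancel hm' (ENNReal.natCast_ne_top m)]
end

section
/- Let β ∈ (0, 2), θ₁, θ₂ > 0, and let f : ℝ → ℝ be a bounded measurable function with f(x + 1) = f(x) for all x ∈ ℝ. Define g(x) = exp(−θ₁ x − θ₂ f(x))·1_{(0,∞)}(x). Then for all u₁, u₂ ≥ 0, ∫_ℝ |u₁ g(x) + u₂ g(x + 1)|^β dx = u₂^β ∫_0^1 exp(−β(θ₁ x + θ₂ f(x))) dx + (u₁ + u₂ e^{−θ₁})^β ∫_0^∞ exp(−β(θ₁ x + θ₂ f(x))) dx. -/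
/-- Exponential decay perturbed by a bounded measurable exponent is integrable on half-lines. -/
theorem integrableOn_exp_neg_mul_add_bounded {β θ₁ θ₂ : ℝ} (hβ : 0 < β) (hθ₁ : 0 < θ₁)
    {f : ℝ → ℝ} (hf : Measurable f) (hf_bdd : ∃ M, ∀ x, |f x| ≤ M) (a : ℝ) :
    MeasureTheory.IntegrableOn (fun x => Real.exp (-(β * (θ₁ * x + θ₂ * f x)))) (Set.Ioi a) := by
  obtain ⟨M, hM⟩ := hf_bdd
  have hexp := (exp_neg_integrableOn_Ioi a (mul_pos hβ hθ₁)).const_mul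
    (Real.exp (β * (|θ₂| * M)))
  refine MeasureTheory.Integrable.mono' hexp (by fun_prop) (Filter.Eventually.of_forall fun x => ?_)
  rw [Real.norm_eq_abs, Real.abs_exp, ← Real.exp_add, Real.exp_le_exp]
  have h : -(θ₂ * f x) ≤ |θ₂| * M :=
    (neg_le_abs _).trans (by rw [abs_mul]; exact mul_le_mul_of_nonneg_left (hM x) (abs_nonneg _))
  nlinarith [mul_le_mul_of_nonneg_left h hβ.le]

/-- Appendix A.3 (Example 2.4) of the paper: explicit β-norm formula for the
periodic Ornstein–Uhlenbeck-type kernel `g(x) = e^{−θ₁x − θ₂ f(x)} 1_{(0,∞)}(x)`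
with `f` bounded, measurable and 1-periodic: for `u₁, u₂ ≥ 0`,
`∫ |u₁ g(x) + u₂ g(x+1)|^β dx
  = u₂^β ∫_0^1 e^{−β(θ₁x+θ₂f(x))} dx + (u₁+u₂e^{−θ₁})^β ∫_0^∞ e^{−β(θ₁x+θ₂f(x))} dx`. -/
theorem stmt6 (β θ₁ θ₂ : ℝ) (hβ0 : 0 < β) (hβ2 : β < 2) (hθ₁ : 0 < θ₁) (hθ₂ : 0 < θ₂)
    (f : ℝ → ℝ) (hf_meas : Measurable f) (hf_bdd : ∃ M, ∀ x, |f x| ≤ M)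
    (hf_per : ∀ x, f (x + 1) = f x)
    (u₁ u₂ : ℝ) (hu₁ : 0 ≤ u₁) (hu₂ : 0 ≤ u₂) :
    (∫ x : ℝ,
        |u₁ * Set.indicator (Set.Ioi (0:ℝ)) (fun y => Real.exp (-θ₁ * y - θ₂ * f y)) x
          + u₂ * Set.indicator (Set.Ioi (0:ℝ)) (fun y => Real.exp (-θ₁ * y - θ₂ * f y)) (x + 1)| ^ β)
    = u₂ ^ β * (∫ x in (0:ℝ)..1, Real.exp (-(β * (θ₁ * x + θ₂ * f x))))
      + (u₁ + u₂ * Real.exp (-θ₁)) ^ β *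
          (∫ x in Set.Ioi (0:ℝ), Real.exp (-(β * (θ₁ * x + θ₂ * f x)))) := by
  set E : ℝ → ℝ := fun x => Real.exp (-(β * (θ₁ * x + θ₂ * f x))) with hE
  have hint : ∀ a, MeasureTheory.IntegrableOn E (Set.Ioi a) :=
    integrableOn_exp_neg_mul_add_bounded hβ0 hθ₁ hf_meas hf_bdd
  have hper : ∀ x, E (x + 1) = Real.exp (-(β * θ₁)) * E x := fun x => by
    simp only [hE, hf_per, ← Real.exp_add]
    ring_nf
  have hpow : ∀ c, 0 ≤ c → ∀ x,
      |c * Real.exp (-θ₁ * x - θ₂ * f x)| ^ β = c ^ β * E x := fun c hc x => by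
    rw [abs_of_nonneg (by positivity), Real.mul_rpow hc (Real.exp_pos _).le, ← Real.exp_mul]
    simp only [hE]
    ring_nf
  have hsplit : (fun x : ℝ =>
        |u₁ * Set.indicator (Set.Ioi (0:ℝ)) (fun y => Real.exp (-θ₁ * y - θ₂ * f y)) x
          + u₂ * Set.indicator (Set.Ioi (0:ℝ)) (fun y => Real.exp (-θ₁ * y - θ₂ * f y)) (x + 1)| ^ β)
      = fun x => Set.indicator (Set.Ioc (-1) 0) (fun x => u₂ ^ β * E (x + 1)) x
        + Set.indicator (Set.Ioi 0) (fun x => (u₁ + u₂ * Real.exp (-θ₁)) ^ β * E x) x := by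
    funext x
    rcases lt_or_ge 0 x with hx | hx
    · have hx1 : 0 < x + 1 := by linarith
      rw [Set.indicator_of_mem (Set.mem_Ioi.2 hx), Set.indicator_of_mem (Set.mem_Ioi.2 hx1),
        Set.indicator_of_notMem (fun h => not_lt.2 h.2 hx),
        Set.indicator_of_mem (Set.mem_Ioi.2 hx), zero_add, ← hpow _ (by positivity), hf_per,
        add_mul, mul_assoc u₂, ← Real.exp_add]
      ring_nf
    · rw [Set.indicator_of_notMem (s := Set.Ioi 0) (a := x) (not_lt.2 hx),
        Set.indicator_of_notMem (s := Set.Ioi 0) (a := x) (not_lt.2 hx), mul_zero, zero_add,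
        add_zero]
      rcases lt_or_ge (-1) x with hx1 | hx1
      · rw [Set.indicator_of_mem (Set.mem_Ioi.2 (by linarith)),
          Set.indicator_of_mem (Set.mem_Ioc.2 ⟨hx1, hx⟩), hpow _ hu₂]
      · rw [Set.indicator_of_notMem (by simp only [Set.mem_Ioi]; linarith),
          Set.indicator_of_notMem (fun h => not_lt.2 hx1 h.1), mul_zero, abs_zero,
          Real.zero_rpow hβ0.ne']
  have hleft : MeasureTheory.IntegrableOn (fun x => u₂ ^ β * E (x + 1)) (Set.Ioc (-1) 0) := by
    simp only [hper]
    exact (((hint (-1)).mono_set Set.Ioc_subset_Ioi_self).const_mul _).const_mul _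
  have hright : MeasureTheory.IntegrableOn
      (fun x => (u₁ + u₂ * Real.exp (-θ₁)) ^ β * E x) (Set.Ioi 0) := (hint 0).const_mul _
  rw [hsplit, MeasureTheory.integral_add (hleft.integrable_indicator measurableSet_Ioc)
      (hright.integrable_indicator measurableSet_Ioi),
    MeasureTheory.integral_indicator measurableSet_Ioc,
    MeasureTheory.integral_indicator measurableSet_Ioi,
    MeasureTheory.integral_const_mul, MeasureTheory.integral_const_mul,
    ← intervalIntegral.integral_of_le (by norm_num), intervalIntegral.integral_comp_add_right]
  norm_num
end

section
/- Let β ∈ (0, 2) with β ≠ 1, let c ∈ (0, 1), and let K₁, K₂, K₃, K₄, K₅ > 0. Define, on the domain D = {(u₁, u₂) ∈ ℝ² : u₁ > u₂ ≥ 0}, the functions F₁(u₁, u₂) = K₁ u₂^β + K₂ (u₁ + u₂)^{β−1} u₂ + K₃ (u₁ + u₂ c)^β and F₂(u₁, u₂) = K₄ u₂^β + K₅ (u₁ + u₂ c)^β. If a, b ∈ ℝ satisfy a·F₁(u₁, u₂) + b·F₂(u₁, u₂) = 0 for all (u₁, u₂) ∈ D, then a = b = 0; in particular F₁ and F₂ are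 linearly independent on D. -/
/-- Linear independence verified in Appendix A.3 of the paper: for `β ∈ (0,2)`, `β ≠ 1`,
`c ∈ (0,1)` and strictly positive constants `K₁,…,K₅`, the functions
`F₁(u₁,u₂) = K₁u₂^β + K₂(u₁+u₂)^{β−1}u₂ + K₃(u₁+u₂c)^β` and
`F₂(u₁,u₂) = K₄u₂^β + K₅(u₁+u₂c)^β` are linearly independent on
`D = {(u₁,u₂) : u₁ > u₂ ≥ 0}`. -/
theorem stmt8 (β : ℝ) (hβ0 : 0 < β) (hβ2 : β < 2) (hβ1 : β ≠ 1)
    (c : ℝ) (hc : c ∈ Set.Ioo (0:ℝ) 1)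
    (K₁ K₂ K₃ K₄ K₅ : ℝ) (hK₁ : 0 < K₁) (hK₂ : 0 < K₂) (hK₃ : 0 < K₃)
    (hK₄ : 0 < K₄) (hK₅ : 0 < K₅)
    (a b : ℝ)
    (h : ∀ u₁ u₂ : ℝ, 0 ≤ u₂ → u₂ < u₁ →
      a * (K₁ * u₂ ^ β + K₂ * (u₁ + u₂) ^ (β - 1) * u₂ + K₃ * (u₁ + u₂ * c) ^ β)
        + b * (K₄ * u₂ ^ β + K₅ * (u₁ + u₂ * c) ^ β) = 0) :
    a = 0 ∧ b = 0 := by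
  have hsum : a * K₃ + b * K₅ = 0 := by
    have h₀ := h 1 0 le_rfl one_pos
    simp only [Real.zero_rpow hβ0.ne', zero_mul, mul_zero, add_zero, zero_add,
      Real.one_rpow, mul_one] at h₀
    exact h₀
  have h₂ := h 2 1 zero_le_one (by norm_num)
  have h₃ := h 3 1 zero_le_one (by norm_num)
  have hpow : ((2 : ℝ) + 1) ^ (β - 1) - (3 + 1) ^ (β - 1) ≠ 0 := by
    intro heq
    have := (Real.rpow_left_inj (by norm_num) (by norm_num) (sub_ne_zero.mpr hβ1)).mp
      (sub_eq_zero.mp heq)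
    norm_num at this
  have hprod : a * (K₂ * (((2 : ℝ) + 1) ^ (β - 1) - (3 + 1) ^ (β - 1))) = 0 := by
    linear_combination h₂ - h₃ - ((2 + 1 * c) ^ β - (3 + 1 * c) ^ β) * hsum
  have ha : a = 0 := (mul_eq_zero.mp hprod).resolve_right (mul_ne_zero hK₂.ne' hpow)
  rw [ha, zero_mul, zero_add] at hsum
  exact ⟨ha, (mul_eq_zero.mp hsum).resolve_right hK₅.ne'⟩
end

section
/- Let β ∈ (1, 2) and let θ = (θ₁, θ₂), θ̃ = (θ̃₁, θ̃₂) ∈ (0, ∞)². If ∫_0^∞ (θ₁ s e^{−θ₂ s})^β ds = ∫_0^∞ (θ̃₁ s e^{−θ̃₂ s})^β ds and ∫_0^∞ θ₁(s+1) e^{−θ₂(s+1)} (θ₁ s e^{−θ₂ s})^{β−1} ds = ∫_0^∞ θ̃₁(s+1) e^{−θ̃₂(s+1)} (θ̃₁ s e^{−θ̃₂ s})^{β−1} ds, then θ = θ̃. -/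
open MeasureTheory in
theorem integrableOn_rpow_mul_exp_neg_mul_Ioi {p r : ℝ} (hp : -1 < p) (hr : 0 < r) :
    IntegrableOn (fun s : ℝ ↦ s ^ p * Real.exp (-(r * s))) (Set.Ioi 0) := by
  simpa [neg_mul] using integrableOn_rpow_mul_exp_neg_mul_rpow hp one_pos hr

theorem rpow_modulated_kernel {a b s : ℝ} (p : ℝ) (ha : 0 < a) (hs : 0 < s) :
    (a * s * Real.exp (-b * s)) ^ p = a ^ p * (s ^ p * Real.exp (-(p * b * s))) := by
  rw [Real.mul_rpow (by positivity) (by positivity), Real.mul_rpow ha.le hs.le,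
    ← Real.exp_mul, mul_assoc]
  ring_nf

theorem integral_rpow_modulated_kernel {a b p : ℝ} (ha : 0 < a) (hb : 0 < b) (hp : 0 < p) :
    ∫ s in Set.Ioi (0:ℝ), (a * s * Real.exp (-b * s)) ^ p
      = a ^ p * ((1 / (p * b)) ^ (p + 1) * Real.Gamma (p + 1)) := by
  rw [MeasureTheory.setIntegral_congr_fun measurableSet_Ioi
    (fun s hs ↦ rpow_modulated_kernel p ha hs), MeasureTheory.integral_const_mul,
    ← Real.integral_rpow_mul_exp_neg_mul_Ioi (by positivity) (by positivity)]
  simp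

theorem integral_modulated_kernel_lag_one {a b p : ℝ} (ha : 0 < a) (hb : 0 < b) (hp : 0 < p) :
    ∫ s in Set.Ioi (0:ℝ),
        a * (s + 1) * Real.exp (-b * (s + 1)) * (a * s * Real.exp (-b * s)) ^ (p - 1)
      = (∫ s in Set.Ioi (0:ℝ), (a * s * Real.exp (-b * s)) ^ p)
        * ((1 + b) * Real.exp (-b)) := by
  have hpb : 0 < p * b := by positivity
  have hcongr : Set.EqOn
      (fun s : ℝ ↦ a * (s + 1) * Real.exp (-b * (s + 1))
        * (a * s * Real.exp (-b * s)) ^ (p - 1))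
      (fun s ↦ a ^ p * Real.exp (-b) * (s ^ p * Real.exp (-(p * b * s))
        + s ^ (p - 1) * Real.exp (-(p * b * s)))) (Set.Ioi 0) := by
    intro s hs
    have hs : 0 < s := hs
    have hexp : Real.exp (-b * (s + 1)) * Real.exp (-((p - 1) * b * s))
        = Real.exp (-b) * Real.exp (-(p * b * s)) := by
      rw [← Real.exp_add, ← Real.exp_add]
      ring_nf
    have hpow : ∀ x : ℝ, 0 < x → x ^ p = x * x ^ (p - 1) := fun x hx ↦ by
      rw [Real.rpow_sub_one hx.ne']
      field_simp
    simp only [rpow_modulated_kernel (p - 1) ha hs, hpow a ha, hpow s hs]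
    linear_combination a * a ^ (p - 1) * (s + 1) * s ^ (p - 1) * hexp
  have hpower : ∫ s in Set.Ioi (0:ℝ), s ^ p * Real.exp (-(p * b * s))
      = (1 / (p * b)) ^ (p + 1) * Real.Gamma (p + 1) := by
    rw [← Real.integral_rpow_mul_exp_neg_mul_Ioi (by positivity) hpb]
    simp
  rw [MeasureTheory.setIntegral_congr_fun measurableSet_Ioi hcongr,
    MeasureTheory.integral_const_mul,
    MeasureTheory.integral_add
      (integrableOn_rpow_mul_exp_neg_mul_Ioi (by linarith) hpb)
      (integrableOn_rpow_mul_exp_neg_mul_Ioi (by linarith) hpb),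
    hpower, Real.integral_rpow_mul_exp_neg_mul_Ioi hp hpb,
    integral_rpow_modulated_kernel ha hb hp, Real.Gamma_add_one hp.ne',
    Real.rpow_add_one (by positivity)]
  field_simp

theorem strictAntiOn_one_add_mul_exp_neg :
    StrictAntiOn (fun x : ℝ ↦ (1 + x) * Real.exp (-x)) (Set.Ioi 0) := by
  intro x hx y _ hxy
  have hx : 0 < x := hx
  have hexp : Real.exp (-x) = Real.exp (y - x) * Real.exp (-y) := by
    rw [← Real.exp_add]
    ring_nf
  simp only [hexp, ← mul_assoc]
  gcongr
  nlinarith [Real.add_one_le_exp (y - x), mul_pos hx (sub_pos.2 hxy)]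

/-- Identifiability claim of Example 2.5 (Appendix A.4) of the paper: for `β ∈ (1,2)`,
the scale integral `∫_0^∞ (θ₁ s e^{−θ₂ s})^β ds` together with the lag-1 covariation
integral `∫_0^∞ θ₁(s+1)e^{−θ₂(s+1)}(θ₁ s e^{−θ₂ s})^{β−1} ds` determines
`θ = (θ₁, θ₂) ∈ (0,∞)²` uniquely. -/
theorem stmt10 (β θ₁ θ₂ θ₁' θ₂' : ℝ) (hβ1 : 1 < β) (hβ2 : β < 2)
    (hθ₁ : 0 < θ₁) (hθ₂ : 0 < θ₂) (hθ₁' : 0 < θ₁') (hθ₂' : 0 < θ₂')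
    (h1 : (∫ s in Set.Ioi (0:ℝ), (θ₁ * s * Real.exp (-θ₂ * s)) ^ β)
        = ∫ s in Set.Ioi (0:ℝ), (θ₁' * s * Real.exp (-θ₂' * s)) ^ β)
    (h2 : (∫ s in Set.Ioi (0:ℝ),
            θ₁ * (s + 1) * Real.exp (-θ₂ * (s + 1)) * (θ₁ * s * Real.exp (-θ₂ * s)) ^ (β - 1))
        = ∫ s in Set.Ioi (0:ℝ),
            θ₁' * (s + 1) * Real.exp (-θ₂' * (s + 1)) * (θ₁' * s * Real.exp (-θ₂' * s)) ^ (β - 1)) :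
    θ₁ = θ₁' ∧ θ₂ = θ₂' := by
  have hβ : 0 < β := by linarith
  rw [integral_modulated_kernel_lag_one hθ₁ hθ₂ hβ,
    integral_modulated_kernel_lag_one hθ₁' hθ₂' hβ, ← h1,
    integral_rpow_modulated_kernel hθ₁ hθ₂ hβ] at h2
  have hGamma : 0 < Real.Gamma (β + 1) := Real.Gamma_pos_of_pos (by linarith)
  obtain rfl : θ₂ = θ₂' :=
    strictAntiOn_one_add_mul_exp_neg.injOn hθ₂ hθ₂' (mul_left_cancel₀ (by positivity) h2)
  rw [integral_rpow_modulated_kernel hθ₁ hθ₂ hβ,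
    integral_rpow_modulated_kernel hθ₁' hθ₂ hβ] at h1
  exact ⟨(Real.rpow_left_inj hθ₁.le hθ₁'.le hβ.ne').1
    (mul_right_cancel₀ (by positivity) h1), rfl⟩
end

section
/- Let β ∈ (1, 2) and θ₂ > 0. For (u₁, u₂) in D = {(u₁, u₂) : u₁ > u₂ ≥ 0} define h_{u}(x) = u₁ x e^{−θ₂ x}·1_{(0,∞)}(x) + u₂ (x+1) e^{−θ₂ (x+1)}·1_{(−1,∞)}(x), and set f₁(u₁, u₂) = ∫_ℝ h_u(x)^β dx and f₂(u₁, u₂) = −∫_ℝ h_u(x)^{β−1} (u₁ x² e^{−θ₂ x}·1_{(0,∞)}(x) + u₂ (x+1)² e^{−θ₂(x+1)}·1_{(−1,∞)}(x)) dx. If a, b ∈ ℝ satisfy a·f₁(u₁, u₂) + b·f₂(u₁, u₂) = 0 for all (u₁, u₂) ∈ D, then a = b = 0; in particular f₁ and f₂ are linearly independent on D. -/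
open Real Set MeasureTheory

/-- A shifted Gamma-type integrand is integrable on the positive half-line. -/
lemma integrableOn_add_rpow_mul_exp {l e s : ℝ} (hl : 0 < l) (he : 0 ≤ e) (hs : -1 < s) :
    IntegrableOn (fun x => (x + e) ^ s * exp (-l * x)) (Ioi 0) := by
  have h : IntegrableOn (fun x : ℝ => x ^ s * exp (-l * x)) (Ioi e) := by
    have := integrableOn_rpow_mul_exp_neg_mul_rpow hs one_pos hl
    simp only [rpow_one] at this
    exact this.mono_set (Ioi_subset_Ioi he)
  have h2 : IntegrableOn (fun x : ℝ => (x + e) ^ s * exp (-l * (x + e))) (Ioi 0) := by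
    rw [← (measurePreserving_add_right volume e).integrableOn_comp_preimage
      (measurableEmbedding_addRight e)] at h
    simpa [Function.comp_def] using h
  refine IntegrableOn.congr_fun (h2.mul_const (exp (l * e))) (fun x _ => ?_) measurableSet_Ioi
  simp only [mul_assoc, ← exp_add]
  ring_nf

/-- Integration by parts for shifted Gamma-type integrals. -/
lemma integral_add_rpow_mul_exp_recurrence {l e s : ℝ} (hl : 0 < l) (he : 0 ≤ e) (hs : 0 < s) :
    l * ∫ x in Ioi (0 : ℝ), (x + e) ^ s * exp (-l * x)
      = e ^ s + s * ∫ x in Ioi (0 : ℝ), (x + e) ^ (s - 1) * exp (-l * x) := by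
  have i1 := (integrableOn_add_rpow_mul_exp hl he (by linarith : -1 < s)).const_mul l
  have i2 := (integrableOn_add_rpow_mul_exp hl he (by linarith : -1 < s - 1)).const_mul s
  have hd : ∀ x ∈ Ioi (0 : ℝ), HasDerivAt (fun x => (x + e) ^ s * exp (-l * x))
      (s * ((x + e) ^ (s - 1) * exp (-l * x)) - l * ((x + e) ^ s * exp (-l * x))) x := by
    intro x hx
    have hx : 0 < x := hx
    have h1 := ((hasDerivAt_id' x).add_const e).rpow_const (p := s)
      (Or.inl (by positivity))
    have h2 := ((hasDerivAt_id' x).const_mul (-l)).exp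
    refine (h1.mul h2).congr_deriv ?_
    ring
  have hc : ContinuousWithinAt (fun x => (x + e) ^ s * exp (-l * x)) (Ici 0) 0 := by
    apply Continuous.continuousWithinAt
    have : Continuous fun x : ℝ => (x + e) ^ s :=
      (continuous_id.add continuous_const).rpow_const fun _ => Or.inr hs.le
    fun_prop
  have ht := tendsto_zero_of_hasDerivAt_of_integrableOn_Ioi hd (i2.sub i1)
    (integrableOn_add_rpow_mul_exp hl he (by linarith : -1 < s))
  have key := integral_Ioi_of_hasDerivAt_of_tendsto hc hd (i2.sub i1) ht
  rw [integral_sub i2 i1, integral_const_mul, integral_const_mul] at key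
  simp only [zero_add, mul_zero, exp_zero, mul_one] at key
  linarith

/-- Integration by parts for incomplete Gamma integrals over the unit interval. -/
lemma integral_unit_rpow_mul_exp_recurrence {l s : ℝ} (hs : 1 ≤ s) :
    l * ∫ x in (0 : ℝ)..1, x ^ s * exp (-l * x)
      = -exp (-l) + s * ∫ x in (0 : ℝ)..1, x ^ (s - 1) * exp (-l * x) := by
  have c1 : Continuous fun x : ℝ => x ^ s :=
    continuous_id.rpow_const fun _ => Or.inr (by linarith)
  have c2 : Continuous fun x : ℝ => x ^ (s - 1) :=
    continuous_id.rpow_const fun _ => Or.inr (by linarith)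
  have i1 : IntervalIntegrable (fun x : ℝ => l * (x ^ s * exp (-l * x))) volume 0 1 :=
    Continuous.intervalIntegrable (by fun_prop) _ _
  have i2 : IntervalIntegrable (fun x : ℝ => s * (x ^ (s - 1) * exp (-l * x))) volume 0 1 :=
    Continuous.intervalIntegrable (by fun_prop) _ _
  have hd : ∀ x ∈ uIcc (0 : ℝ) 1, HasDerivAt (fun x => x ^ s * exp (-l * x))
      (s * (x ^ (s - 1) * exp (-l * x)) - l * (x ^ s * exp (-l * x))) x := by
    intro x _
    have h1 := (hasDerivAt_id' x).rpow_const (p := s) (Or.inr hs)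
    have h2 := ((hasDerivAt_id' x).const_mul (-l)).exp
    refine (h1.mul h2).congr_deriv ?_
    ring
  have key := intervalIntegral.integral_eq_sub_of_hasDerivAt hd (i2.sub i1)
  rw [intervalIntegral.integral_sub i2 i1, intervalIntegral.integral_const_mul,
    intervalIntegral.integral_const_mul] at key
  rw [zero_rpow (by linarith)] at key
  simp only [one_rpow, one_mul, mul_one, zero_mul, sub_zero] at key
  linarith

lemma integral_add_rpow_mul_exp_pos {l e s : ℝ} (hl : 0 < l) (he : 0 ≤ e) (hs : -1 < s) :
    0 < ∫ x in Ioi (0 : ℝ), (x + e) ^ s * exp (-l * x) := by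
  have hpos : ∀ x ∈ Ioi (0 : ℝ), 0 < (x + e) ^ s * exp (-l * x) := fun x hx => by
    have hx : 0 < x := hx
    positivity
  rw [setIntegral_pos_iff_support_of_nonneg_ae
    (ae_restrict_of_forall_mem measurableSet_Ioi fun x hx => (hpos x hx).le)
    (integrableOn_add_rpow_mul_exp hl he hs),
    inter_eq_self_of_subset_right fun x hx => Function.mem_support.2 (hpos x hx).ne']
  simp

/-- Splitting of the integral of a function vanishing on `(-∞, -1]`. -/
lemma integral_eq_Ioi_add_unit {H F G : ℝ → ℝ} (hF : ∀ x, 0 < x → H x = F x)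
    (hG : ∀ x, -1 < x → x ≤ 0 → H x = G (x + 1)) (h0 : ∀ x ≤ -1, H x = 0)
    (iF : IntegrableOn F (Ioi 0)) (cG : Continuous G) :
    ∫ x, H x = (∫ x in Ioi (0 : ℝ), F x) + ∫ y in (0 : ℝ)..1, G y := by
  have e1 : ∫ x in Ioi (0 : ℝ), H x = ∫ x in Ioi (0 : ℝ), F x :=
    setIntegral_congr_fun measurableSet_Ioi fun x hx => hF x hx
  have i1 : IntegrableOn H (Ioi 0) :=
    iF.congr_fun (fun x hx => (hF x hx).symm) measurableSet_Ioi
  have e2 : ∫ x in Ioc (-1 : ℝ) 0, H x = ∫ y in (0 : ℝ)..1, G y := by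
    have := intervalIntegral.integral_comp_add_right (a := -1) (b := 0) G 1
    rw [neg_add_cancel, zero_add] at this
    rw [← this, intervalIntegral.integral_of_le (by norm_num)]
    exact setIntegral_congr_fun measurableSet_Ioc fun x hx => hG x hx.1 hx.2
  have i2 : IntegrableOn H (Ioc (-1) 0) := by
    refine IntegrableOn.congr_fun (f := fun x => G (x + 1)) ?_
      (fun x hx => (hG x hx.1 hx.2).symm) measurableSet_Ioc
    exact Continuous.integrableOn_Ioc (by fun_prop)
  have hsupp : ∫ x, H x = ∫ x in Ioi (-1 : ℝ), H x :=
    (setIntegral_eq_integral_of_forall_compl_eq_zero fun x hx => h0 x (not_lt.1 hx)).symm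
  rw [hsupp, ← Ioc_union_Ioi_eq_Ioi (by norm_num : (-1 : ℝ) ≤ 0),
    setIntegral_union (Ioc_disjoint_Ioi le_rfl) measurableSet_Ioi i2 i1, e1, e2, add_comm]

lemma mul_exp_rpow {p c x t : ℝ} (hp : 0 ≤ p) :
    (p * exp (-c * x)) ^ t = p ^ t * exp (-(c * t) * x) := by
  rw [mul_rpow hp (exp_pos _).le, ← exp_mul]
  ring_nf

lemma integral_kernel_rpow {β c e : ℝ} (hβ : 1 < β) (hc : 0 < c) (he : 0 ≤ e) :
    ∫ x : ℝ, ((1 - e) * indicator (Ioi (0:ℝ)) (fun y => y * exp (-c * y)) x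
        + e * exp c * indicator (Ioi (-1:ℝ)) (fun y => (y + 1) * exp (-c * (y + 1))) x) ^ β
      = (∫ x in Ioi (0 : ℝ), (x + e) ^ β * exp (-(c * β) * x))
        + (e * exp c) ^ β * ∫ y in (0 : ℝ)..1, y ^ β * exp (-(c * β) * y) := by
  rw [← intervalIntegral.integral_const_mul]
  apply integral_eq_Ioi_add_unit
  · intro x hx
    rw [indicator_of_mem (mem_Ioi.2 hx), indicator_of_mem (mem_Ioi.2 (by linarith)),
      ← mul_exp_rpow (by positivity)]
    congr 1
    rw [show -c * (x + 1) = -c * x + -c by ring, exp_add, exp_neg c]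
    field_simp
    ring
  · intro x hx hx'
    have : 0 < x + 1 := by linarith
    rw [indicator_of_notMem (notMem_Ioi.2 hx'), indicator_of_mem (mem_Ioi.2 hx), mul_zero,
      zero_add, mul_rpow (by positivity) (by positivity), mul_exp_rpow this.le]
  · intro x hx
    rw [indicator_of_notMem (notMem_Ioi.2 (by linarith)), indicator_of_notMem (notMem_Ioi.2 hx),
      mul_zero, mul_zero, zero_add, zero_rpow (by linarith)]
  · exact integrableOn_add_rpow_mul_exp (by positivity) he (by linarith)
  · have : Continuous fun y : ℝ => y ^ β :=
      continuous_id.rpow_const fun _ => Or.inr (by linarith)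
    fun_prop

lemma integral_kernel_rpow_mul {β c e : ℝ} (hβ : 1 < β) (hc : 0 < c) (he : 0 ≤ e) :
    ∫ x : ℝ, ((1 - e) * indicator (Ioi (0:ℝ)) (fun y => y * exp (-c * y)) x
        + e * exp c * indicator (Ioi (-1:ℝ)) (fun y => (y + 1) * exp (-c * (y + 1))) x) ^ (β - 1)
        * ((1 - e) * indicator (Ioi (0:ℝ)) (fun y => y ^ 2 * exp (-c * y)) x
        + e * exp c * indicator (Ioi (-1:ℝ)) (fun y => (y + 1) ^ 2 * exp (-c * (y + 1))) x)
      = (∫ x in Ioi (0 : ℝ), (x + e) ^ (β + 1) * exp (-(c * β) * x))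
        + e * (1 - e) * (∫ x in Ioi (0 : ℝ), (x + e) ^ (β - 1) * exp (-(c * β) * x))
        + (e * exp c) ^ β * ∫ y in (0 : ℝ)..1, y ^ (β + 1) * exp (-(c * β) * y) := by
  have hl : 0 < c * β := by positivity
  have i1 := integrableOn_add_rpow_mul_exp hl he (by linarith : -1 < β + 1)
  have i2 := (integrableOn_add_rpow_mul_exp hl he (by linarith : -1 < β - 1)).const_mul
    (e * (1 - e))
  have hexp : ∀ x : ℝ, exp (-(c * β) * x) = exp (-(c * (β - 1)) * x) * exp (-c * x) := by
    intro x
    rw [← exp_add]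
    ring_nf
  have hpow : ∀ x : ℝ, 0 < x → x ^ (β + 1) = x ^ (β - 1) * x ^ 2 := by
    intro x hx
    rw [← rpow_natCast, ← rpow_add hx]
    norm_num
    ring_nf
  rw [← intervalIntegral.integral_const_mul, ← integral_const_mul, ← integral_add i1 i2]
  apply integral_eq_Ioi_add_unit
  · intro x hx
    have hxe : 0 < x + e := by positivity
    rw [indicator_of_mem (mem_Ioi.2 hx), indicator_of_mem (mem_Ioi.2 hx),
      indicator_of_mem (mem_Ioi.2 (by linarith)), indicator_of_mem (mem_Ioi.2 (by linarith)),
      hpow _ hxe, hexp]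
    have hE : exp (-c * (x + 1)) = exp (-c * x) * (exp c)⁻¹ := by
      rw [← exp_neg, ← exp_add]
      ring_nf
    have h1 : (1 - e) * (x * exp (-c * x)) + e * exp c * ((x + 1) * exp (-c * (x + 1)))
        = (x + e) * exp (-c * x) := by
      rw [hE]
      field_simp
      ring
    have h2 : (1 - e) * (x ^ 2 * exp (-c * x)) + e * exp c * ((x + 1) ^ 2 * exp (-c * (x + 1)))
        = ((x + e) ^ 2 + e * (1 - e)) * exp (-c * x) := by
      rw [hE]
      field_simp
      ring
    rw [h1, h2, mul_exp_rpow hxe.le]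
    ring
  · intro x hx hx'
    have hx1 : 0 < x + 1 := by linarith
    have hE : 0 ≤ e * exp c := by positivity
    have hEβ : (e * exp c) ^ β = (e * exp c) ^ (β - 1) * (e * exp c) := by
      rw [← rpow_add_one' hE (by linarith), sub_add_cancel]
    rw [indicator_of_notMem (notMem_Ioi.2 hx'), indicator_of_notMem (notMem_Ioi.2 hx'),
      indicator_of_mem (mem_Ioi.2 hx), indicator_of_mem (mem_Ioi.2 hx), mul_zero,
      zero_add, zero_add, mul_rpow hE (by positivity), mul_exp_rpow hx1.le, hpow _ hx1, hexp, hEβ]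
    ring
  · intro x hx
    rw [indicator_of_notMem (notMem_Ioi.2 (by linarith)), indicator_of_notMem (notMem_Ioi.2 hx),
      mul_zero, mul_zero, zero_add, zero_rpow (by linarith), zero_mul]
  · exact i1.add i2
  · have : Continuous fun y : ℝ => y ^ (β + 1) :=
      continuous_id.rpow_const fun _ => Or.inr (by linarith)
    fun_prop


/-- Appendix A.4 (Example 2.5) of the paper: linear independence, on
`D = {(u₁,u₂) : u₁ > u₂ ≥ 0}`, of the two parameter derivatives
`f₁(u) = ∫ h_u(x)^β dx` and
`f₂(u) = −∫ h_u(x)^{β−1}(u₁x²e^{−θ₂x}1_{(0,∞)}(x) + u₂(x+1)²e^{−θ₂(x+1)}1_{(−1,∞)}(x)) dx`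
of the joint β-norm of the modulated Ornstein–Uhlenbeck kernel, where
`h_u(x) = u₁xe^{−θ₂x}1_{(0,∞)}(x) + u₂(x+1)e^{−θ₂(x+1)}1_{(−1,∞)}(x)`. -/
theorem stmt11 (β θ₂ : ℝ) (hβ1 : 1 < β) (hβ2 : β < 2) (hθ₂ : 0 < θ₂) (a b : ℝ)
    (h : ∀ u₁ u₂ : ℝ, 0 ≤ u₂ → u₂ < u₁ →
      a * (∫ x : ℝ,
            (u₁ * Set.indicator (Set.Ioi (0:ℝ)) (fun y => y * Real.exp (-θ₂ * y)) x
              + u₂ * Set.indicator (Set.Ioi (-1:ℝ))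
                  (fun y => (y + 1) * Real.exp (-θ₂ * (y + 1))) x) ^ β)
        + b * (-(∫ x : ℝ,
            (u₁ * Set.indicator (Set.Ioi (0:ℝ)) (fun y => y * Real.exp (-θ₂ * y)) x
              + u₂ * Set.indicator (Set.Ioi (-1:ℝ))
                  (fun y => (y + 1) * Real.exp (-θ₂ * (y + 1))) x) ^ (β - 1)
            * (u₁ * Set.indicator (Set.Ioi (0:ℝ)) (fun y => y ^ 2 * Real.exp (-θ₂ * y)) x
              + u₂ * Set.indicator (Set.Ioi (-1:ℝ))
                  (fun y => (y + 1) ^ 2 * Real.exp (-θ₂ * (y + 1))) x))) = 0) :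
    a = 0 ∧ b = 0 := by
  have hl : 0 < θ₂ * β := by positivity
  have key : ∀ e : ℝ, 0 ≤ e → e * (1 + exp θ₂) < 1 →
      a * ((∫ x in Ioi (0 : ℝ), (x + e) ^ β * exp (-(θ₂ * β) * x))
        + (e * exp θ₂) ^ β * ∫ y in (0 : ℝ)..1, y ^ β * exp (-(θ₂ * β) * y))
      + b * (-((∫ x in Ioi (0 : ℝ), (x + e) ^ (β + 1) * exp (-(θ₂ * β) * x))
        + e * (1 - e) * (∫ x in Ioi (0 : ℝ), (x + e) ^ (β - 1) * exp (-(θ₂ * β) * x))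
        + (e * exp θ₂) ^ β * ∫ y in (0 : ℝ)..1, y ^ (β + 1) * exp (-(θ₂ * β) * y))) = 0 := by
    intro e he he1
    rw [← integral_kernel_rpow hβ1 hθ₂ he, ← integral_kernel_rpow_mul hβ1 hθ₂ he]
    exact h (1 - e) (e * exp θ₂) (by positivity) (by linarith)
  have hβ0 : β ≠ 0 := by positivity
  have hab : θ₂ * β * a = (β + 1) * b := by
    have h0 := key 0 le_rfl (by simp)
    have r0 := integral_add_rpow_mul_exp_recurrence hl le_rfl (by linarith : 0 < β + 1)
    have p0 := integral_add_rpow_mul_exp_pos hl le_rfl (by linarith : -1 < β)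
    rw [zero_rpow (by linarith), add_sub_cancel_right] at r0
    simp only [zero_mul, zero_rpow hβ0, add_zero] at h0 r0 p0
    refine mul_right_cancel₀ p0.ne' ?_
    linear_combination θ₂ * β * h0 + b * r0
  obtain ⟨e, he, he1⟩ : ∃ e : ℝ, 0 < e ∧ e * (1 + exp θ₂) < 1 := by
    refine ⟨(2 + exp θ₂)⁻¹, by positivity, ?_⟩
    rw [inv_mul_lt_one₀ (by positivity)]
    linarith
  have he2 : e < 1 := by nlinarith [mul_pos he (exp_pos θ₂)]
  have hk := key e he.le he1
  have r1 := integral_add_rpow_mul_exp_recurrence hl he.le (by linarith : 0 < β + 1)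
  have r2 := integral_add_rpow_mul_exp_recurrence hl he.le (by linarith : 0 < β - 1)
  have r3 := integral_unit_rpow_mul_exp_recurrence (l := θ₂ * β) (by linarith : 1 ≤ β + 1)
  have p2 := integral_add_rpow_mul_exp_pos hl he.le (by linarith : -1 < β - 1 - 1)
  have hE : (e * exp θ₂) ^ β * exp (-(θ₂ * β)) = e ^ β := by
    rw [mul_rpow he.le (exp_pos _).le, ← exp_mul, mul_assoc, ← exp_add, add_neg_cancel,
      exp_zero, mul_one]
  have hp1 : e ^ (β + 1) = e ^ β * e := rpow_add_one he.ne' β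
  have hp2 : e ^ β = e ^ (β - 1) * e := by rw [← rpow_add_one he.ne', sub_add_cancel]
  rw [add_sub_cancel_right] at r1 r3
  have hb : b = 0 := by
    have hne : e * (1 - e) * ((β - 1) *
        ∫ x in Ioi (0 : ℝ), (x + e) ^ (β - 1 - 1) * exp (-(θ₂ * β) * x)) ≠ 0 :=
      (mul_pos (mul_pos he (sub_pos.2 he2)) (mul_pos (sub_pos.2 hβ1) p2)).ne'
    refine (mul_eq_zero.1 (?_ : b * _ = 0)).resolve_right hne
    generalize (∫ x in Ioi (0 : ℝ), (x + e) ^ β * exp (-(θ₂ * β) * x)) = I at *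
    generalize (∫ x in Ioi (0 : ℝ), (x + e) ^ (β + 1) * exp (-(θ₂ * β) * x)) = I1 at *
    generalize (∫ x in Ioi (0 : ℝ), (x + e) ^ (β - 1) * exp (-(θ₂ * β) * x)) = J at *
    generalize (∫ x in Ioi (0 : ℝ), (x + e) ^ (β - 1 - 1) * exp (-(θ₂ * β) * x)) = J1 at *
    generalize (∫ y in (0 : ℝ)..1, y ^ β * exp (-(θ₂ * β) * y)) = A at *
    generalize (∫ y in (0 : ℝ)..1, y ^ (β + 1) * exp (-(θ₂ * β) * y)) = A1 at *
    generalize (e * exp θ₂) ^ β = E at *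
    linear_combination (-(θ₂ * β)) * hk + (I + E * A) * hab - b * r1 - b * e * (1 - e) * r2
      - b * E * r3 + b * hE - b * hp1 + b * (1 - e) * hp2
  refine ⟨?_, hb⟩
  rw [hb, mul_zero] at hab
  exact (mul_eq_zero.1 hab).resolve_left hl.ne'
end

section
/- Let β ∈ (1, 2), λ < 0 and θ > 0, and set c = ∫_0^∞ (1 + θx)^β e^{λβx} dx. Then ∫_0^∞ (1 + θ(x+1)) e^{λ(x+1)} (1 + θx)^{β−1} e^{λ(β−1)x} dx = e^{λ} (c(1 − λ) − β^{−1}). -/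
open Asymptotics Filter in
/-- A power of an increasing affine function costs at most half of the exponential decay rate. -/
lemma isBigO_affine_rpow_mul_exp {θ b : ℝ} (hθ : 0 < θ) (hb : b < 0) (p : ℝ) :
    (fun x : ℝ => (1 + θ * x) ^ p * Real.exp (b * x)) =O[atTop]
      fun x => Real.exp (-(-b / 2) * x) := by
  have haffine : Tendsto (fun x : ℝ => 1 + θ * x) atTop atTop :=
    tendsto_atTop_add_const_left _ _ (tendsto_id.const_mul_atTop hθ)
  have hpow : (fun x : ℝ => (1 + θ * x) ^ p) =O[atTop] fun x => Real.exp (-b / 2 * x) := by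
    refine ((isLittleO_rpow_exp_pos_mul_atTop p
      (div_pos (neg_pos.2 hb) (mul_pos two_pos hθ))).comp_tendsto haffine).isBigO.trans ?_
    refine IsBigO.of_bound (Real.exp (-b / (2 * θ))) (Eventually.of_forall fun x => ?_)
    rw [Function.comp_apply, Real.norm_of_nonneg (Real.exp_nonneg _),
      Real.norm_of_nonneg (Real.exp_nonneg _), ← Real.exp_add]
    refine le_of_eq (congrArg Real.exp ?_)
    field_simp
    ring
  refine (hpow.mul (isBigO_refl (fun x : ℝ => Real.exp (b * x)) atTop)).congr_right fun x => ?_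
  rw [← Real.exp_add]
  ring_nf

open Set MeasureTheory in
lemma integrableOn_affine_rpow_mul_exp {θ b : ℝ} (hθ : 0 < θ) (hb : b < 0) (p : ℝ) :
    IntegrableOn (fun x : ℝ => (1 + θ * x) ^ p * Real.exp (b * x)) (Ioi 0) := by
  refine integrable_of_isBigO_exp_neg (b := -b / 2) (by linarith) ?_
    (isBigO_affine_rpow_mul_exp hθ hb p)
  refine ContinuousOn.mul (ContinuousOn.rpow_const (by fun_prop) fun x hx => Or.inl ?_)
    (by fun_prop)
  have := mul_nonneg hθ.le (mem_Ici.1 hx)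
  positivity

open Filter Topology in
lemma tendsto_affine_rpow_mul_exp {θ b : ℝ} (hθ : 0 < θ) (hb : b < 0) (p : ℝ) :
    Tendsto (fun x : ℝ => (1 + θ * x) ^ p * Real.exp (b * x)) atTop (𝓝 0) := by
  refine (isBigO_affine_rpow_mul_exp hθ hb p).trans_tendsto (Real.tendsto_exp_atBot.comp ?_)
  exact tendsto_id.const_mul_atTop_of_neg (by linarith)

open Set MeasureTheory in
/-- Integration by parts, equivalent to the recursion of the incomplete gamma function. -/
lemma integral_affine_rpow_mul_exp_recursion {θ b : ℝ} (hθ : 0 < θ) (hb : b < 0) (p : ℝ) :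
    p * θ * (∫ x in Ioi (0 : ℝ), (1 + θ * x) ^ (p - 1) * Real.exp (b * x))
      + b * (∫ x in Ioi (0 : ℝ), (1 + θ * x) ^ p * Real.exp (b * x)) = -1 := by
  have hderiv : ∀ x ∈ Ici (0 : ℝ),
      HasDerivAt (fun x : ℝ => (1 + θ * x) ^ p * Real.exp (b * x))
        (p * θ * ((1 + θ * x) ^ (p - 1) * Real.exp (b * x))
          + b * ((1 + θ * x) ^ p * Real.exp (b * x))) x := by
    intro x hx
    have hpos : 0 < 1 + θ * x := by
      have := mul_nonneg hθ.le (mem_Ici.1 hx)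
      positivity
    have haffine : HasDerivAt (fun x : ℝ => 1 + θ * x) θ x := by
      simpa using ((hasDerivAt_id x).const_mul θ).const_add 1
    have hexp : HasDerivAt (fun x : ℝ => Real.exp (b * x)) (Real.exp (b * x) * b) x := by
      simpa using ((hasDerivAt_id x).const_mul b).exp
    refine ((haffine.rpow_const (p := p) (Or.inl hpos.ne')).mul hexp).congr_deriv ?_
    ring
  have hint := (integrableOn_affine_rpow_mul_exp hθ hb (p - 1)).const_mul (p * θ)
  have hint' := (integrableOn_affine_rpow_mul_exp hθ hb p).const_mul b
  rw [← integral_const_mul, ← integral_const_mul, ← integral_add hint hint',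
    integral_Ioi_of_hasDerivAt_of_tendsto' hderiv (hint.add hint')
      (tendsto_affine_rpow_mul_exp hθ hb p)]
  simp

/-- Appendix A.5 (Example 2.6) of the paper: for `β ∈ (1,2)`, `λ < 0`, `θ > 0` and
`c = ∫_0^∞ (1+θx)^β e^{λβx} dx`, the lag-1 covariation integral of the CARMA(2,1)
kernel `g(s) = (1+θs)e^{λs} 1_{[0,∞)}(s)` equals `e^λ (c(1−λ) − β⁻¹)`. -/
theorem stmt13 (β lam θ c : ℝ) (hβ1 : 1 < β) (hβ2 : β < 2) (hlam : lam < 0) (hθ : 0 < θ)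
    (hc : c = ∫ x in Set.Ioi (0:ℝ), (1 + θ * x) ^ β * Real.exp (lam * β * x)) :
    (∫ x in Set.Ioi (0:ℝ),
        (1 + θ * (x + 1)) * Real.exp (lam * (x + 1)) * (1 + θ * x) ^ (β - 1)
          * Real.exp (lam * (β - 1) * x))
    = Real.exp lam * (c * (1 - lam) - β⁻¹) := by
  have hb : lam * β < 0 := mul_neg_of_neg_of_pos hlam (by linarith)
  have hrec := integral_affine_rpow_mul_exp_recursion hθ hb β
  have hcongr : Set.EqOn
      (fun x : ℝ => (1 + θ * (x + 1)) * Real.exp (lam * (x + 1)) * (1 + θ * x) ^ (β - 1)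
        * Real.exp (lam * (β - 1) * x))
      (fun x => Real.exp lam * ((1 + θ * x) ^ β * Real.exp (lam * β * x)
        + θ * ((1 + θ * x) ^ (β - 1) * Real.exp (lam * β * x)))) (Set.Ioi 0) := by
    intro x hx
    have hpos : 0 < 1 + θ * x := by
      have := mul_pos hθ (Set.mem_Ioi.1 hx)
      positivity
    have hpow : (1 + θ * x) ^ β = (1 + θ * x) ^ (β - 1) * (1 + θ * x) := by
      rw [← Real.rpow_add_one hpos.ne', sub_add_cancel]
    have hexp : Real.exp (lam * (x + 1)) * Real.exp (lam * (β - 1) * x)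
        = Real.exp lam * Real.exp (lam * β * x) := by
      rw [← Real.exp_add, ← Real.exp_add]
      ring_nf
    simp only [hpow]
    linear_combination (1 + θ * (x + 1)) * (1 + θ * x) ^ (β - 1) * hexp
  rw [MeasureTheory.setIntegral_congr_fun measurableSet_Ioi hcongr,
    MeasureTheory.integral_const_mul,
    MeasureTheory.integral_add (integrableOn_affine_rpow_mul_exp hθ hb β)
      ((integrableOn_affine_rpow_mul_exp hθ hb (β - 1)).const_mul θ),
    MeasureTheory.integral_const_mul, ← hc]
  rw [← hc] at hrec
  have hβ : β ≠ 0 := by linarith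
  congr 1
  apply mul_left_cancel₀ hβ
  linear_combination hrec + mul_inv_cancel₀ hβ
end

section
/- Let β ∈ (1, 2) and let (λ, θ), (λ', θ') with λ, λ' < 0 and θ, θ' > 0. If ∫_0^∞ (1 + θx)^β e^{λβx} dx = ∫_0^∞ (1 + θ'x)^β e^{λ'βx} dx and ∫_0^∞ (1 + θ(x+1)) e^{λ(x+1)} (1 + θx)^{β−1} e^{λ(β−1)x} dx = ∫_0^∞ (1 + θ'(x+1)) e^{λ'(x+1)} (1 + θ'x)^{β−1} e^{λ'(β−1)x} dx, then λ = λ' and θ = θ'. -/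
open MeasureTheory Set Filter Asymptotics Topology

lemma setIntegral_Ioi_pos {f : ℝ → ℝ} {a : ℝ} (hf : IntegrableOn f (Ioi a))
    (hpos : ∀ x ∈ Ioi a, 0 < f x) : 0 < ∫ x in Ioi a, f x := by
  rw [setIntegral_pos_iff_support_of_nonneg_ae
    (ae_restrict_of_forall_mem measurableSet_Ioi fun x hx => (hpos x hx).le) hf,
    inter_eq_right.mpr (show Ioi a ⊆ Function.support f from fun x hx => (hpos x hx).ne')]
  simp

lemma one_add_mul_rpow_isLittleO_exp {θ b : ℝ} (p : ℝ) (hθ : 0 < θ) (hb : 0 < b) :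
    (fun x : ℝ => (1 + θ * x) ^ p) =o[atTop] fun x => Real.exp (b * x) := by
  have hlim : Tendsto (fun x : ℝ => 1 + θ * x) atTop atTop :=
    tendsto_atTop_add_const_left _ _ (tendsto_id.const_mul_atTop hθ)
  refine ((isLittleO_rpow_exp_pos_mul_atTop p (div_pos hb hθ)).comp_tendsto hlim).trans_isBigO ?_
  refine IsBigO.of_bound (Real.exp (b / θ)) (Eventually.of_forall fun x => ?_)
  have : b / θ * (1 + θ * x) = b / θ + b * x := by field_simp
  simp [this, Real.exp_add]

lemma one_add_mul_rpow_mul_exp_isLittleO {θ k : ℝ} (p : ℝ) (hθ : 0 < θ) (hk : k < 0) :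
    (fun x : ℝ => (1 + θ * x) ^ p * Real.exp (k * x)) =o[atTop]
      fun x => Real.exp (-(-k / 2) * x) := by
  refine ((one_add_mul_rpow_isLittleO_exp p hθ (b := -k / 2) (by linarith)).mul_isBigO
    (isBigO_refl (fun x => Real.exp (k * x)) atTop)).congr_right fun x => ?_
  rw [← Real.exp_add]
  ring_nf

lemma continuousOn_one_add_mul_rpow_mul_exp {θ : ℝ} (p k : ℝ) (hθ : 0 < θ) :
    ContinuousOn (fun x : ℝ => (1 + θ * x) ^ p * Real.exp (k * x)) (Ici 0) := by
  refine ContinuousOn.mul (ContinuousOn.rpow_const (by fun_prop) fun x hx => Or.inl ?_)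
    (by fun_prop)
  have : 0 ≤ θ * x := mul_nonneg hθ.le hx
  positivity

lemma integrableOn_one_add_mul_rpow_mul_exp {θ k : ℝ} (p : ℝ) (hθ : 0 < θ) (hk : k < 0) :
    IntegrableOn (fun x : ℝ => (1 + θ * x) ^ p * Real.exp (k * x)) (Ioi 0) :=
  integrable_of_isBigO_exp_neg (by linarith) (continuousOn_one_add_mul_rpow_mul_exp p k hθ)
    (one_add_mul_rpow_mul_exp_isLittleO p hθ hk).isBigO

lemma tendsto_one_add_mul_rpow_mul_exp {θ k : ℝ} (p : ℝ) (hθ : 0 < θ) (hk : k < 0) :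
    Tendsto (fun x : ℝ => (1 + θ * x) ^ p * Real.exp (k * x)) atTop (𝓝 0) := by
  refine (one_add_mul_rpow_mul_exp_isLittleO p hθ hk).isBigO.trans_tendsto ?_
  exact Real.tendsto_exp_atBot.comp (tendsto_id.const_mul_atTop_of_neg (by linarith))

/-- Integration by parts for `∫_0^∞ (1 + θ x)^p e^{k x} dx`. -/
lemma integral_one_add_mul_rpow_mul_exp_by_parts {θ k : ℝ} (p : ℝ) (hθ : 0 < θ) (hk : k < 0) :
    p * θ * (∫ x in Ioi (0 : ℝ), (1 + θ * x) ^ (p - 1) * Real.exp (k * x))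
      + k * (∫ x in Ioi (0 : ℝ), (1 + θ * x) ^ p * Real.exp (k * x)) = -1 := by
  have hi1 := (integrableOn_one_add_mul_rpow_mul_exp (p - 1) hθ hk).const_mul (p * θ)
  have hi0 := (integrableOn_one_add_mul_rpow_mul_exp p hθ hk).const_mul k
  have hderiv : ∀ x ∈ Ioi (0 : ℝ),
      HasDerivAt (fun x : ℝ => (1 + θ * x) ^ p * Real.exp (k * x))
        (p * θ * ((1 + θ * x) ^ (p - 1) * Real.exp (k * x))
          + k * ((1 + θ * x) ^ p * Real.exp (k * x))) x := by
    intro x hx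
    have hpos : 0 < 1 + θ * x := by
      have := mul_pos hθ hx
      linarith
    have hlin : HasDerivAt (fun x : ℝ => 1 + θ * x) θ x := by
      simpa using ((hasDerivAt_id x).const_mul θ).const_add 1
    have hexp : HasDerivAt (fun x : ℝ => Real.exp (k * x)) (Real.exp (k * x) * k) x := by
      simpa using ((hasDerivAt_id x).const_mul k).exp
    refine ((hlin.rpow_const (p := p) (Or.inl hpos.ne')).mul hexp).congr_deriv ?_
    ring
  have hftc := integral_Ioi_of_hasDerivAt_of_tendsto
    (continuousOn_one_add_mul_rpow_mul_exp p k hθ 0 self_mem_Ici)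
    hderiv (hi1.add hi0) (tendsto_one_add_mul_rpow_mul_exp p hθ hk)
  rw [integral_add hi1 hi0, integral_const_mul, integral_const_mul] at hftc
  simpa using hftc

/-- The lag-one covariation integral in terms of the scale integral. -/
lemma integral_lag_one_covariation {β lam θ : ℝ} (hβ : 0 < β) (hlam : lam < 0) (hθ : 0 < θ) :
    (∫ x in Ioi (0 : ℝ),
        (1 + θ * (x + 1)) * Real.exp (lam * (x + 1)) * (1 + θ * x) ^ (β - 1)
          * Real.exp (lam * (β - 1) * x))
      = Real.exp lam *
        ((∫ x in Ioi (0 : ℝ), (1 + θ * x) ^ β * Real.exp (lam * β * x)) * (1 - lam) - β⁻¹) := by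
  have hk : lam * β < 0 := mul_neg_of_neg_of_pos hlam hβ
  have hi1 := (integrableOn_one_add_mul_rpow_mul_exp (β - 1) hθ hk).const_mul θ
  have hi0 := integrableOn_one_add_mul_rpow_mul_exp β hθ hk
  have hparts := integral_one_add_mul_rpow_mul_exp_by_parts β hθ hk
  have hsplit : ∀ x ∈ Ioi (0 : ℝ),
      (1 + θ * (x + 1)) * Real.exp (lam * (x + 1)) * (1 + θ * x) ^ (β - 1)
          * Real.exp (lam * (β - 1) * x)
        = Real.exp lam * ((1 + θ * x) ^ β * Real.exp (lam * β * x)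
          + θ * ((1 + θ * x) ^ (β - 1) * Real.exp (lam * β * x))) := by
    intro x hx
    have hpos : 0 < 1 + θ * x := by
      have := mul_pos hθ hx
      linarith
    have hexp : Real.exp (lam * (x + 1)) * Real.exp (lam * (β - 1) * x)
        = Real.exp lam * Real.exp (lam * β * x) := by
      rw [← Real.exp_add, ← Real.exp_add]
      ring_nf
    have hpow : (1 + θ * x) ^ β = (1 + θ * x) ^ (β - 1) * (1 + θ * x) := by
      rw [← Real.rpow_add_one hpos.ne', sub_add_cancel]
    rw [hpow]
    linear_combination (1 + θ * (x + 1)) * (1 + θ * x) ^ (β - 1) * hexp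
  rw [setIntegral_congr_fun measurableSet_Ioi hsplit, integral_const_mul,
    integral_add hi0 hi1, integral_const_mul]
  have hsolve : ∀ A I : ℝ, β * θ * I + lam * β * A = -1 → A + θ * I = A * (1 - lam) - β⁻¹ := by
    intro A I h
    field_simp
    linear_combination h
  rw [hsolve _ _ hparts]

lemma inv_lt_neg_mul_scale_integral {β lam θ : ℝ} (hβ : 0 < β) (hlam : lam < 0) (hθ : 0 < θ) :
    β⁻¹ < -lam * ∫ x in Ioi (0 : ℝ), (1 + θ * x) ^ β * Real.exp (lam * β * x) := by
  have hk : lam * β < 0 := mul_neg_of_neg_of_pos hlam hβ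
  have hpos := setIntegral_Ioi_pos (integrableOn_one_add_mul_rpow_mul_exp (β - 1) hθ hk)
    fun x hx => by
      have := mul_pos hθ hx
      positivity
  have hparts := integral_one_add_mul_rpow_mul_exp_by_parts β hθ hk
  have := mul_pos (mul_pos hβ hθ) hpos
  rw [inv_lt_iff_one_lt_mul₀ hβ]
  linarith

lemma exp_mul_affine_lt {c d l l' : ℝ} (hc : 0 < c) (hl : l < l') (hd : d < -l' * c) :
    Real.exp l * (c * (1 - l) - d) < Real.exp l' * (c * (1 - l') - d) := by
  have hexp : Real.exp l' = Real.exp l * Real.exp (l' - l) := by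
    rw [← Real.exp_add]
    ring_nf
  rw [hexp, mul_assoc]
  refine mul_lt_mul_of_pos_left ?_ (Real.exp_pos l)
  have hA : c < c * (1 - l') - d := by linarith
  have := mul_le_mul_of_nonneg_right (Real.add_one_le_exp (l' - l)) (hc.trans hA).le
  nlinarith [mul_lt_mul_of_pos_right hA (sub_pos.mpr hl)]

lemma scale_integral_strictMonoOn {β lam : ℝ} (hβ : 0 < β) (hlam : lam < 0) :
    StrictMonoOn (fun θ : ℝ => ∫ x in Ioi (0 : ℝ), (1 + θ * x) ^ β * Real.exp (lam * β * x))
      (Ioi 0) := by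
  intro θ hθ θ' hθ' hlt
  have hk : lam * β < 0 := mul_neg_of_neg_of_pos hlam hβ
  have hi := integrableOn_one_add_mul_rpow_mul_exp β hθ hk
  have hi' := integrableOn_one_add_mul_rpow_mul_exp β hθ' hk
  have hpos := setIntegral_Ioi_pos (hi'.sub hi) fun x hx => by
    have hx0 : 0 < θ * x := mul_pos hθ hx
    have hpow : (1 + θ * x) ^ β < (1 + θ' * x) ^ β :=
      Real.rpow_lt_rpow (by linarith) (by linarith [mul_lt_mul_of_pos_right hlt hx]) hβ
    exact sub_pos.mpr (mul_lt_mul_of_pos_right hpow (Real.exp_pos _))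
  have hsub := integral_sub hi' hi
  simp only [Pi.sub_apply] at hpos
  exact sub_pos.mp (hsub ▸ hpos)


/-- Identifiability claim of Example 2.6 (Appendix A.5) of the paper: for `β ∈ (1,2)`,
the scale integral `∫_0^∞ (1+θx)^β e^{λβx} dx` together with the lag-1 covariation
integral determines the CARMA(2,1) parameters `λ < 0` and `θ > 0` uniquely. -/
theorem stmt14 (β lam θ lam' θ' : ℝ) (hβ1 : 1 < β) (hβ2 : β < 2)
    (hlam : lam < 0) (hθ : 0 < θ) (hlam' : lam' < 0) (hθ' : 0 < θ')
    (h1 : (∫ x in Set.Ioi (0:ℝ), (1 + θ * x) ^ β * Real.exp (lam * β * x))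
        = ∫ x in Set.Ioi (0:ℝ), (1 + θ' * x) ^ β * Real.exp (lam' * β * x))
    (h2 : (∫ x in Set.Ioi (0:ℝ),
            (1 + θ * (x + 1)) * Real.exp (lam * (x + 1)) * (1 + θ * x) ^ (β - 1)
              * Real.exp (lam * (β - 1) * x))
        = ∫ x in Set.Ioi (0:ℝ),
            (1 + θ' * (x + 1)) * Real.exp (lam' * (x + 1)) * (1 + θ' * x) ^ (β - 1)
              * Real.exp (lam' * (β - 1) * x)) :
    lam = lam' ∧ θ = θ' := by
  have hβ : 0 < β := by linarith
  have hbound := inv_lt_neg_mul_scale_integral hβ hlam hθ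
  have hbound' := inv_lt_neg_mul_scale_integral hβ hlam' hθ'
  rw [integral_lag_one_covariation hβ hlam hθ, integral_lag_one_covariation hβ hlam' hθ',
    ← h1] at h2
  rw [← h1] at hbound'
  have hc := pos_of_mul_pos_right ((inv_pos.mpr hβ).trans hbound) (neg_pos.mpr hlam).le
  have hl : lam = lam' := by
    rcases lt_trichotomy lam lam' with hlt | heq | hgt
    · exact absurd h2 (exp_mul_affine_lt hc hlt hbound').ne
    · exact heq
    · exact absurd h2 (exp_mul_affine_lt hc hgt hbound).ne'
  subst hl
  exact ⟨rfl, (scale_integral_strictMonoOn hβ hlam).injOn hθ hθ' h1⟩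
end

section
/- Let β ∈ (0, 2), m ∈ ℕ with m ≥ 1, and let g : ℝ → ℝ be measurable with g(x) = 0 for x ≤ 0, satisfying |g(x)| ≤ K(x^κ·1_{[0,1)}(x) + x^{−α}·1_{[1,∞)}(x)) for all x ≥ 0, with K > 0, κ > −1/β and αβ > 2. For ℓ ∈ ℤ and u, v ∈ ℝ^m define U_ℓ(u, v) = exp(−∫_ℝ |Σ_{i=1}^m (u_i g(i − x) + v_i g(i + ℓ − x))|^β dx) − exp(−∫_ℝ |Σ_{i=1}^m u_i g(i − x)|^β dx − ∫_ℝ |Σ_{i=1}^m v_i g(i + ℓ − x)|^β dx), and set r_ℓ(u, v) = (U_ℓ(u, −v) + U_ℓ(u, v))/2. Then for every T > 0 there exists a constant C_T > 0 such that Σ_{ℓ ∈ ℤ} |r_ℓ(u, u) − r_ℓ(u, v)| ≤ C_T ‖u − v‖₁^{β/2} for all u, v ∈ [0, T]^m, where ‖·‖₁ denotes the ℓ¹-norm on ℝ^m. -/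
open Set

/-- The dependence measure `U_{Z₀,Z_ℓ}(u,v)` between the stable vectors
`Z₀ = (X₁,…,X_m)` and `Z_ℓ = (X_{1+ℓ},…,X_{m+ℓ})` of the β-stable moving average
with kernel `g`, expressed through β-norms of the kernel. -/
noncomputable def Udep (β : ℝ) (g : ℝ → ℝ) (m : ℕ) (ℓ : ℤ) (u v : Fin m → ℝ) : ℝ :=
  Real.exp (-(∫ x : ℝ,
      |∑ i : Fin m, (u i * g (((i : ℕ) : ℝ) + 1 - x)
        + v i * g (((i : ℕ) : ℝ) + 1 + (ℓ : ℝ) - x))| ^ β))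
  - Real.exp (-(∫ x : ℝ, |∑ i : Fin m, u i * g (((i : ℕ) : ℝ) + 1 - x)| ^ β)
      - (∫ x : ℝ, |∑ i : Fin m, v i * g (((i : ℕ) : ℝ) + 1 + (ℓ : ℝ) - x)| ^ β))

/-- `r_ℓ(u,v) = cov(cos⟨u,Z₀⟩, cos⟨v,Z_ℓ⟩) = (U_{Z₀,Z_ℓ}(u,−v) + U_{Z₀,Z_ℓ}(u,v))/2`. -/
noncomputable def rdep (β : ℝ) (g : ℝ → ℝ) (m : ℕ) (ℓ : ℤ) (u v : Fin m → ℝ) : ℝ :=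
  (Udep β g m ℓ u (-v) + Udep β g m ℓ u v) / 2

open MeasureTheory
open scoped ENNReal

/-- Subadditivity of `x ↦ |x| ^ p` for `p ≤ 1`, in difference form. -/
lemma abs_abs_rpow_sub_abs_rpow_le {p : ℝ} (hp0 : 0 ≤ p) (hp1 : p ≤ 1) (x y : ℝ) :
    |(|x| ^ p - |y| ^ p)| ≤ |x - y| ^ p := by
  have key : ∀ x y : ℝ, |x| ^ p ≤ |x - y| ^ p + |y| ^ p := fun x y =>
    calc |x| ^ p = |(x - y) + y| ^ p := by rw [sub_add_cancel]
      _ ≤ (|x - y| + |y|) ^ p :=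
        Real.rpow_le_rpow (abs_nonneg _) (abs_add_le _ _) hp0
      _ ≤ _ := Real.rpow_add_le_add_rpow (abs_nonneg _) (abs_nonneg _) hp0 hp1
  rw [abs_le]
  have h1 := key x y
  have h2 := key y x
  rw [abs_sub_comm y x] at h2
  constructor <;> linarith

/-- The signed power `x ↦ x |x| ^ (γ - 1)` is `γ`-Hölder continuous for `γ ∈ (0, 1]`. -/
lemma abs_signed_rpow_sub_le {γ : ℝ} (h0 : 0 < γ) (h1 : γ ≤ 1) (x y : ℝ) :
    |(|x| ^ (γ - 1) * x - |y| ^ (γ - 1) * y)| ≤ 2 * |x - y| ^ γ := by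
  have pos : ∀ z : ℝ, 0 ≤ z → |z| ^ (γ - 1) * z = |z| ^ γ := by
    intro z hz
    rcases hz.eq_or_lt with rfl | hz
    · simp [h0.ne']
    · rw [abs_of_pos hz, Real.rpow_sub_one hz.ne', div_mul_cancel₀ _ hz.ne']
  have neg : ∀ z : ℝ, z ≤ 0 → |z| ^ (γ - 1) * z = -|z| ^ γ := by
    intro z hz
    have := pos (-z) (by linarith)
    rw [abs_neg] at this
    linarith
  have hnn : 0 ≤ |x - y| ^ γ := by positivity
  have mixed : ∀ a b : ℝ, |a| ≤ |x - y| → |b| ≤ |x - y| →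
      |a| ^ γ + |b| ^ γ ≤ 2 * |x - y| ^ γ := by
    intro a b ha hb
    have := Real.rpow_le_rpow (abs_nonneg _) ha h0.le
    have := Real.rpow_le_rpow (abs_nonneg _) hb h0.le
    linarith
  have hd := abs_abs_rpow_sub_abs_rpow_le h0.le h1 x y
  rcases le_total 0 x with hx | hx <;> rcases le_total 0 y with hy | hy
  · rw [pos x hx, pos y hy]
    linarith
  · rw [pos x hx, neg y hy, sub_neg_eq_add, abs_of_nonneg (by positivity)]
    refine mixed x y ?_ ?_ <;>
    · rw [abs_of_nonneg (by linarith : (0:ℝ) ≤ x - y)]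
      first | rw [abs_of_nonneg hx] | rw [abs_of_nonpos hy]
      linarith
  · rw [neg x hx, pos y hy, ← neg_add', abs_neg, abs_of_nonneg (by positivity)]
    refine mixed x y ?_ ?_ <;>
    · rw [abs_of_nonpos (by linarith : x - y ≤ 0)]
      first | rw [abs_of_nonpos hx] | rw [abs_of_nonneg hy]
      linarith
  · rw [neg x hx, neg y hy, neg_sub_neg, abs_sub_comm]
    linarith

lemma rpow_sub_one_mul_le {β a c : ℝ} (hβ0 : 0 < β) (hβ2 : β < 2) (hc : 0 ≤ c) (hca : c ≤ a) :
    a ^ (β - 1) * c ≤ a ^ (β / 2) * c ^ (β / 2) := by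
  rcases hc.eq_or_lt with rfl | hc
  · simp [(by positivity : β / 2 ≠ 0)]
  have ha : 0 < a := hc.trans_le hca
  calc a ^ (β - 1) * c = a ^ (β - 1) * (c ^ (β / 2) * c ^ (1 - β / 2)) := by
        rw [← Real.rpow_add hc, add_sub_cancel, Real.rpow_one]
    _ ≤ a ^ (β - 1) * (c ^ (β / 2) * a ^ (1 - β / 2)) := by
        gcongr
        linarith
    _ = (a ^ (β - 1) * a ^ (1 - β / 2)) * c ^ (β / 2) := by ring
    _ = a ^ (β / 2) * c ^ (β / 2) := by
        rw [← Real.rpow_add ha]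
        congr 2
        ring

/-- The mixed second difference of `x ↦ |x| ^ β` for `β ∈ (0, 2)` with increments `a`, `c` is
bounded by `|a c| ^ (β / 2)` up to a constant. -/
lemma abs_second_difference_rpow_le {β : ℝ} (hβ0 : 0 < β) (hβ2 : β < 2) (a b c : ℝ) :
    |(|b + a + c| ^ β - |b + a| ^ β - (|b + c| ^ β - |b| ^ β))|
      ≤ 4 * (|a| ^ (β / 2) * |c| ^ (β / 2)) := by
  wlog hca : |c| ≤ |a| generalizing a c
  · have := this c a (le_of_not_ge hca)
    rw [mul_comm (|c| ^ (β / 2)), add_right_comm b c a] at this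
    convert this using 2
    ring
  rcases le_or_gt β 1 with h1 | h1
  · have e1 := abs_abs_rpow_sub_abs_rpow_le hβ0.le h1 (b + a + c) (b + a)
    have e2 := abs_abs_rpow_sub_abs_rpow_le hβ0.le h1 (b + c) b
    rw [add_sub_cancel_left] at e1 e2
    have e3 : |c| ^ β ≤ |a| ^ (β / 2) * |c| ^ (β / 2) := by
      rw [← add_halves β, Real.rpow_add_of_nonneg (abs_nonneg c) (by positivity) (by positivity),
        add_halves]
      gcongr
    have e4 := abs_sub (|b + a + c| ^ β - |b + a| ^ β) (|b + c| ^ β - |b| ^ β)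
    have : 0 ≤ |c| ^ β := by positivity
    linarith
  · have hd : ∀ t ∈ (Set.univ : Set ℝ), HasDerivWithinAt
        (fun t => |b + a + t| ^ β - |b + t| ^ β)
        (β * |b + a + t| ^ (β - 2) * (b + a + t) - β * |b + t| ^ (β - 2) * (b + t)) Set.univ t := by
      intro t _
      refine HasDerivAt.hasDerivWithinAt ?_
      exact ((hasDerivAt_abs_rpow (b + a + t) h1).comp_const_add (b + a) t).sub
        ((hasDerivAt_abs_rpow (b + t) h1).comp_const_add b t)
    have hb : ∀ t ∈ (Set.univ : Set ℝ),
        ‖β * |b + a + t| ^ (β - 2) * (b + a + t) - β * |b + t| ^ (β - 2) * (b + t)‖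
          ≤ 4 * |a| ^ (β - 1) := by
      intro t _
      have := abs_signed_rpow_sub_le (by linarith : 0 < β - 1) (by linarith) (b + a + t) (b + t)
      rw [show β - 1 - 1 = β - 2 by ring, show b + a + t - (b + t) = a by ring] at this
      rw [mul_assoc, mul_assoc, ← mul_sub, Real.norm_eq_abs, abs_mul, abs_of_pos hβ0]
      have h2 : 0 ≤ |a| ^ (β - 1) := by positivity
      nlinarith [abs_nonneg (|b + a + t| ^ (β - 2) * (b + a + t) - |b + t| ^ (β - 2) * (b + t))]
    have := Convex.norm_image_sub_le_of_norm_hasDerivWithin_le hd hb convex_univ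
      (Set.mem_univ 0) (Set.mem_univ c)
    rw [Real.norm_eq_abs, Real.norm_eq_abs, add_zero, add_zero, sub_zero] at this
    have h3 := rpow_sub_one_mul_le hβ0 hβ2 (abs_nonneg c) hca
    calc _ = |(|b + a + c| ^ β - |b + c| ^ β - (|b + a| ^ β - |b| ^ β))| := by congr 1; ring
      _ ≤ 4 * |a| ^ (β - 1) * |c| := this
      _ ≤ _ := by linarith

lemma abs_exp_sub_exp_le {x y M : ℝ} (hx : x ≤ M) (hy : y ≤ M) :
    |Real.exp x - Real.exp y| ≤ Real.exp M * |x - y| := by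
  have key : ∀ x y : ℝ, x ≤ M → y ≤ x → Real.exp x - Real.exp y ≤ Real.exp M * (x - y) := by
    intro x y hx hy
    have h1 : Real.exp x * (y - x + 1) ≤ Real.exp y := by
      calc _ ≤ Real.exp x * Real.exp (y - x) := by gcongr; exact Real.add_one_le_exp _
        _ = _ := by rw [← Real.exp_add, add_sub_cancel]
    have h2 : Real.exp x * (x - y) ≤ Real.exp M * (x - y) := by
      gcongr
    linarith
  rcases le_total x y with h | h
  · rw [abs_sub_comm, abs_sub_comm x, abs_of_nonneg (sub_nonneg.2 (Real.exp_le_exp.2 h)),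
      abs_of_nonneg (sub_nonneg.2 h)]
    exact key y x hy h
  · rw [abs_of_nonneg (sub_nonneg.2 (Real.exp_le_exp.2 h)), abs_of_nonneg (sub_nonneg.2 h)]
    exact key x y hx h

/-- Stability of `exp (-(Y + D)) - exp (-Y)` in `Y ≥ 0` and in the small quantity `D`. -/
lemma abs_exp_difference_sub_le {Y D Y' D' d d₀ e f : ℝ} (hY : 0 ≤ Y) (hY' : 0 ≤ Y')
    (hD : |D| ≤ d) (hD' : |D'| ≤ d₀) (hd : d ≤ d₀) (he : |Y - Y'| ≤ e) (hf : |D - D'| ≤ f) :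
    |(Real.exp (-(Y + D)) - Real.exp (-Y)) - (Real.exp (-(Y' + D')) - Real.exp (-Y'))|
      ≤ Real.exp d₀ * (e * d + f) := by
  have hD0 := (abs_le.1 (hD.trans hd)).1
  have hD0' := (abs_le.1 hD').1
  have hd0 : 0 ≤ d₀ := (abs_nonneg _).trans hD'
  have h1 : |Real.exp (-Y) - Real.exp (-Y')| ≤ e := by
    have := abs_exp_sub_exp_le (M := 0) (neg_nonpos.2 hY) (neg_nonpos.2 hY')
    rw [Real.exp_zero, one_mul, neg_sub_neg, abs_sub_comm Y'] at this
    exact this.trans he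
  have h2 : |Real.exp (-D) - 1| ≤ Real.exp d₀ * d := by
    have := abs_exp_sub_exp_le (x := -D) (y := 0) (M := d₀) (by linarith) hd0
    rw [Real.exp_zero, sub_zero, abs_neg] at this
    exact this.trans (by gcongr)
  have h3 : |Real.exp (-D) - Real.exp (-D')| ≤ Real.exp d₀ * f := by
    have := abs_exp_sub_exp_le (x := -D) (y := -D') (M := d₀) (by linarith) (by linarith)
    rw [neg_sub_neg, abs_sub_comm D'] at this
    exact this.trans (by gcongr)
  have h4 : |Real.exp (-Y')| ≤ 1 := by
    rw [abs_of_pos (Real.exp_pos _)]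
    exact Real.exp_le_one_iff.2 (neg_nonpos.2 hY')
  have he0 : 0 ≤ e := (abs_nonneg _).trans he
  calc _ = |(Real.exp (-Y) - Real.exp (-Y')) * (Real.exp (-D) - 1)
          + Real.exp (-Y') * (Real.exp (-D) - Real.exp (-D'))| := by
        rw [neg_add, neg_add, Real.exp_add, Real.exp_add]
        congr 1
        ring
    _ ≤ |Real.exp (-Y) - Real.exp (-Y')| * |Real.exp (-D) - 1|
          + |Real.exp (-Y')| * |Real.exp (-D) - Real.exp (-D')| := by
        rw [← abs_mul, ← abs_mul]
        exact abs_add_le _ _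
    _ ≤ e * (Real.exp d₀ * d) + 1 * (Real.exp d₀ * f) := by gcongr
    _ = _ := by ring

/-- The total correlation at integer lags of a function supported on `(0, ∞)` which is locally
square integrable at `0` and decays like an integrable power at infinity is finite. -/
lemma tsum_lintegral_mul_add_int_ne_top {w : ℝ → ℝ≥0∞} (hw : Measurable w) {a p c : ℝ}
    (ha : -1 < 2 * a) (hp : 1 < p) (hc : 0 ≤ c) (hw_zero : ∀ x ≤ 0, w x = 0)
    (hw_near : ∀ x, 0 < x → x < 1 → w x ≤ ENNReal.ofReal (c * x ^ a))
    (hw_far : ∀ x, 1 ≤ x → w x ≤ ENNReal.ofReal (c * x ^ (-p))) :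
    ∑' k : ℤ, ∫⁻ y, w y * w (y + k) ≠ ∞ := by
  set w₀ : ℝ → ℝ≥0∞ := (Ioo 0 1).indicator w with hw₀
  set w₁ : ℝ → ℝ≥0∞ := (Ici 1).indicator w with hw₁
  have mw₀ : Measurable w₀ := hw.indicator measurableSet_Ioo
  have mw₁ : Measurable w₁ := hw.indicator measurableSet_Ici
  have hsplit : ∀ x, w x = w₀ x + w₁ x := by
    intro x
    rcases le_or_gt x 0 with h | h
    · rw [hw_zero x h, hw₀, hw₁, indicator_of_notMem, indicator_of_notMem, add_zero]
      · simp only [mem_Ici]; linarith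
      · simp only [mem_Ioo, not_and_or]; left; linarith
    rcases lt_or_ge x 1 with h' | h'
    · rw [hw₀, hw₁, indicator_of_mem (show x ∈ Ioo (0:ℝ) 1 from ⟨h, h'⟩), indicator_of_notMem,
        add_zero]
      simpa using h'
    · rw [hw₀, hw₁, indicator_of_mem (show x ∈ Ici (1:ℝ) from h'), indicator_of_notMem, zero_add]
      simp only [mem_Ioo, not_and_or]; right; linarith
  have hint_sq : ∫⁻ y, w₀ y * w₀ y ≠ ∞ := by
    have hi : IntegrableOn (fun x : ℝ => c ^ 2 * x ^ (2 * a)) (Ioo 0 1) :=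
      ((intervalIntegral.integrableOn_Ioo_rpow_iff one_pos).2 ha).const_mul _
    refine ne_top_of_le_ne_top hi.lintegral_lt_top.ne ?_
    rw [← lintegral_indicator measurableSet_Ioo]
    refine lintegral_mono fun x => ?_
    by_cases hx : x ∈ Ioo (0:ℝ) 1
    · rw [hw₀, indicator_of_mem hx, indicator_of_mem hx]
      refine (mul_le_mul' (hw_near x hx.1 hx.2) (hw_near x hx.1 hx.2)).trans ?_
      have := Real.rpow_nonneg hx.1.le a
      rw [← ENNReal.ofReal_mul (by positivity)]
      refine ENNReal.ofReal_le_ofReal (le_of_eq ?_)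
      rw [two_mul, Real.rpow_add hx.1]
      ring
    · rw [hw₀, indicator_of_notMem hx]
      simp
  have hint₀ : ∫⁻ y, w₀ y ≠ ∞ := by
    have : ∫⁻ y, w₀ y ≤ ∫⁻ y, (w₀ y * w₀ y + (Ioo (0:ℝ) 1).indicator 1 y) := by
      refine lintegral_mono fun x => ?_
      by_cases hx : x ∈ Ioo (0:ℝ) 1
      · rw [indicator_of_mem hx, Pi.one_apply]
        rcases le_total (w₀ x) 1 with h | h
        · exact h.trans le_add_self
        · exact (le_mul_of_one_le_left' h).trans le_self_add
      · rw [hw₀, indicator_of_notMem hx]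
        simp
    refine ne_top_of_le_ne_top ?_ this
    rw [lintegral_add_left (by fun_prop), lintegral_indicator_one measurableSet_Ioo]
    exact ENNReal.add_ne_top.2 ⟨hint_sq, by simp⟩
  have hint₁ : ∫⁻ y, w₁ y ≠ ∞ := by
    have hi : IntegrableOn (fun x : ℝ => c * x ^ (-p)) (Ioi (1 / 2)) :=
      (integrableOn_Ioi_rpow_of_lt (by linarith) (by norm_num)).const_mul _
    refine ne_top_of_le_ne_top hi.lintegral_lt_top.ne ?_
    rw [← lintegral_indicator measurableSet_Ioi]
    refine lintegral_mono fun x => ?_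
    by_cases hx : x ∈ Ici (1:ℝ)
    · rw [hw₁, indicator_of_mem hx, indicator_of_mem]
      · exact hw_far x hx
      · have : (1:ℝ) ≤ x := hx
        simp only [mem_Ioi]
        linarith
    · rw [hw₁, indicator_of_notMem hx]
      simp
  set M : ℝ≥0∞ := ∑' n : ℤ, ENNReal.ofReal (c * |(n : ℝ)| ^ (-p)) with hM
  have hM_top : M ≠ ∞ := by
    rw [hM, ← ENNReal.ofReal_tsum_of_nonneg (fun n => by positivity)
      ((Real.summable_abs_int_rpow hp).mul_left c)]
    exact ENNReal.ofReal_ne_top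
  have hsum : ∀ y, ∑' k : ℤ, w₁ (y + k) ≤ M := by
    intro y
    rw [hM, ← (Equiv.addLeft ⌊y⌋).tsum_eq fun n : ℤ => ENNReal.ofReal (c * |(n : ℝ)| ^ (-p))]
    refine ENNReal.tsum_le_tsum fun k => ?_
    by_cases hx : y + k ∈ Ici (1:ℝ)
    · have h1 : (1:ℝ) ≤ y + k := hx
      have h2 : 1 ≤ ⌊y⌋ + k := by
        rw [← Int.floor_add_intCast]
        exact Int.le_floor.2 (by exact_mod_cast h1)
      have h3 : (1:ℝ) ≤ ((⌊y⌋ + k : ℤ) : ℝ) := by exact_mod_cast h2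
      rw [hw₁, indicator_of_mem hx, Equiv.coe_addLeft, abs_of_nonneg (by linarith)]
      refine (hw_far _ h1).trans (ENNReal.ofReal_le_ofReal ?_)
      refine mul_le_mul_of_nonneg_left ?_ hc
      refine Real.rpow_le_rpow_of_nonpos (by linarith) ?_ (by linarith)
      push_cast
      linarith [Int.floor_le y]
    · rw [hw₁, indicator_of_notMem hx]
      simp
  have hcorr : ∀ u : ℝ → ℝ≥0∞, Measurable u →
      ∑' k : ℤ, ∫⁻ y, u y * w₁ (y + k) ≤ (∫⁻ y, u y) * M := by
    intro u hu
    rw [← lintegral_tsum fun k => by fun_prop, ← lintegral_mul_const _ hu]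
    refine lintegral_mono fun y => ?_
    rw [ENNReal.tsum_mul_left]
    gcongr
    exact hsum y
  have hswap : ∑' k : ℤ, ∫⁻ y, w₁ y * w₀ (y + k) = ∑' k : ℤ, ∫⁻ y, w₀ y * w₁ (y + k) := by
    rw [← (Equiv.neg ℤ).tsum_eq]
    refine tsum_congr fun k => ?_
    rw [← lintegral_add_right_eq_self _ (k : ℝ)]
    refine lintegral_congr fun y => ?_
    rw [mul_comm]
    simp
  have hdiag : ∑' k : ℤ, ∫⁻ y, w₀ y * w₀ (y + k) ≠ ∞ := by
    rw [tsum_eq_single 0]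
    · simpa using hint_sq
    · intro k hk
      rw [← lintegral_zero (μ := (volume : Measure ℝ))]
      refine lintegral_congr fun y => ?_
      by_contra hne
      have h1 : y ∈ Ioo (0:ℝ) 1 := mem_of_indicator_ne_zero (left_ne_zero_of_mul hne)
      have h2 : y + k ∈ Ioo (0:ℝ) 1 := mem_of_indicator_ne_zero (right_ne_zero_of_mul hne)
      have h3 : (k : ℝ) < 1 := by linarith [h1.1, h2.2]
      have h4 : (-1 : ℝ) < k := by linarith [h1.2, h2.1]
      have h5 : k < 1 := by exact_mod_cast h3
      have h6 : -1 < k := by exact_mod_cast h4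
      omega
  have hexpand : ∀ k : ℤ, ∫⁻ y, w y * w (y + k) =
      (∫⁻ y, w₀ y * w₀ (y + k)) + ((∫⁻ y, w₀ y * w₁ (y + k)) + ((∫⁻ y, w₁ y * w₀ (y + k))
        + ∫⁻ y, w₁ y * w₁ (y + k))) := by
    intro k
    rw [← lintegral_add_left (by fun_prop), ← lintegral_add_left (by fun_prop),
      ← lintegral_add_left (by fun_prop)]
    refine lintegral_congr fun y => ?_
    rw [hsplit, hsplit]
    ring
  simp_rw [hexpand]
  rw [ENNReal.tsum_add, ENNReal.tsum_add, ENNReal.tsum_add, hswap]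
  have t₀ := ne_top_of_le_ne_top (ENNReal.mul_ne_top hint₀ hM_top) (hcorr w₀ mw₀)
  have t₁ := ne_top_of_le_ne_top (ENNReal.mul_ne_top hint₁ hM_top) (hcorr w₁ mw₁)
  exact ENNReal.add_ne_top.2 ⟨hdiag, ENNReal.add_ne_top.2 ⟨t₀, ENNReal.add_ne_top.2 ⟨t₀, t₁⟩⟩⟩

/-- The sum of absolute values of the `m` shifted kernels. -/
noncomputable def kernelEnvelope (g : ℝ → ℝ) (m : ℕ) (x : ℝ) : ℝ :=
  ∑ i : Fin m, |g (((i : ℕ) : ℝ) + 1 - x)|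

lemma kernelEnvelope_nonneg (g : ℝ → ℝ) (m : ℕ) (x : ℝ) : 0 ≤ kernelEnvelope g m x :=
  Finset.sum_nonneg fun _ _ => abs_nonneg _

lemma measurable_kernelEnvelope {g : ℝ → ℝ} (hg : Measurable g) (m : ℕ) :
    Measurable (kernelEnvelope g m) := by
  unfold kernelEnvelope
  fun_prop

lemma ofReal_sum_rpow_le {ι : Type*} (s : Finset ι) {f : ι → ℝ} (hf : ∀ i, 0 ≤ f i) {p : ℝ}
    (hp0 : 0 < p) (hp1 : p ≤ 1) :
    ENNReal.ofReal ((∑ i ∈ s, f i) ^ p) ≤ ∑ i ∈ s, ENNReal.ofReal (f i ^ p) := by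
  classical
  induction s using Finset.induction_on with
  | empty => simp [hp0.ne']
  | insert i s hi ih =>
    rw [Finset.sum_insert hi, Finset.sum_insert hi]
    have hs : 0 ≤ ∑ i ∈ s, f i := Finset.sum_nonneg fun i _ => hf i
    calc _ ≤ ENNReal.ofReal (f i ^ p + (∑ i ∈ s, f i) ^ p) :=
          ENNReal.ofReal_le_ofReal (Real.rpow_add_le_add_rpow (hf i) hs hp0.le hp1)
      _ = ENNReal.ofReal (f i ^ p) + ENNReal.ofReal ((∑ i ∈ s, f i) ^ p) :=
          ENNReal.ofReal_add (Real.rpow_nonneg (hf i) p) (Real.rpow_nonneg hs p)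
      _ ≤ _ := by gcongr

/-- The product of the envelope powers at lag `ℓ`. -/
noncomputable def envelopeProd (β : ℝ) (g : ℝ → ℝ) (m : ℕ) (ℓ : ℤ) (x : ℝ) : ℝ :=
  kernelEnvelope g m x ^ (β / 2) * kernelEnvelope g m (x - ℓ) ^ (β / 2)

lemma envelopeProd_nonneg (β : ℝ) (g : ℝ → ℝ) (m : ℕ) (ℓ : ℤ) (x : ℝ) :
    0 ≤ envelopeProd β g m ℓ x :=
  mul_nonneg (Real.rpow_nonneg (kernelEnvelope_nonneg _ _ _) _)
    (Real.rpow_nonneg (kernelEnvelope_nonneg _ _ _) _)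

lemma tsum_lintegral_envelopeProd_ne_top {β : ℝ} (hβ0 : 0 < β) (hβ2 : β < 2) (m : ℕ)
    {g : ℝ → ℝ} (hg_meas : Measurable g) (hg_zero : ∀ x ≤ (0:ℝ), g x = 0)
    {K α κ : ℝ} (hK : 0 < K) (hκ : -1 / β < κ) (hαβ : 2 < α * β)
    (hbound : ∀ x : ℝ, 0 ≤ x →
      |g x| ≤ K * ((Ico (0:ℝ) 1).indicator (fun y => y ^ κ) x
        + (Ici (1:ℝ)).indicator (fun y => y ^ (-α)) x)) :
    ∑' ℓ : ℤ, ∫⁻ x, ENNReal.ofReal (envelopeProd β g m ℓ x) ≠ ∞ := by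
  set w : ℝ → ℝ≥0∞ := fun x => ENNReal.ofReal (|g x| ^ (β / 2)) with hw
  have hwm : Measurable w := by fun_prop
  have hβ : 0 < β / 2 := by positivity
  have hQ : ∑' k : ℤ, ∫⁻ y, w y * w (y + k) ≠ ∞ := by
    refine tsum_lintegral_mul_add_int_ne_top hwm (a := κ * (β / 2)) (p := α * (β / 2))
      (c := K ^ (β / 2)) ?_ (by linarith) (by positivity) ?_ ?_ ?_
    · rw [div_lt_iff₀ hβ0] at hκ
      linarith
    · intro x hx
      simp [hw, hg_zero x hx, hβ.ne']
    · intro x h0 h1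
      refine ENNReal.ofReal_le_ofReal ?_
      have hb := hbound x h0.le
      rw [indicator_of_mem (show x ∈ Ico (0:ℝ) 1 from ⟨h0.le, h1⟩),
        indicator_of_notMem (by simpa using h1), add_zero] at hb
      rw [Real.rpow_mul h0.le, ← Real.mul_rpow hK.le (by positivity)]
      exact Real.rpow_le_rpow (abs_nonneg _) hb hβ.le
    · intro x h1
      have h0 : 0 < x := by linarith
      refine ENNReal.ofReal_le_ofReal ?_
      have hb := hbound x h0.le
      rw [indicator_of_mem (show x ∈ Ici (1:ℝ) from h1),
        indicator_of_notMem (by simp [h1]), zero_add] at hb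
      rw [← neg_mul, Real.rpow_mul h0.le, ← Real.mul_rpow hK.le (by positivity)]
      exact Real.rpow_le_rpow (abs_nonneg _) hb hβ.le
  have hle : ∀ ℓ : ℤ, ∫⁻ x, ENNReal.ofReal (envelopeProd β g m ℓ x) ≤
      ∑ i : Fin m, ∑ j : Fin m, ∫⁻ y, w y * w (y + (((j : ℕ) : ℤ) - ((i : ℕ) : ℤ) + ℓ : ℤ)) := by
    intro ℓ
    calc _ ≤ ∫⁻ x, ∑ i : Fin m, ∑ j : Fin m,
          w (((i : ℕ) : ℝ) + 1 - x) * w (((j : ℕ) : ℝ) + 1 - (x - ℓ)) := by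
          refine lintegral_mono fun x => ?_
          rw [envelopeProd, ENNReal.ofReal_mul (Real.rpow_nonneg (kernelEnvelope_nonneg _ _ _) _),
            ← Finset.sum_mul_sum]
          exact mul_le_mul' (ofReal_sum_rpow_le _ (fun _ => abs_nonneg _) hβ (by linarith))
            (ofReal_sum_rpow_le _ (fun _ => abs_nonneg _) hβ (by linarith))
      _ = ∑ i : Fin m, ∑ j : Fin m, ∫⁻ x,
          w (((i : ℕ) : ℝ) + 1 - x) * w (((j : ℕ) : ℝ) + 1 - (x - ℓ)) := by
          rw [lintegral_finsetSum _ fun i _ => by fun_prop]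
          refine Finset.sum_congr rfl fun i _ => ?_
          rw [lintegral_finsetSum _ fun i _ => by fun_prop]
      _ = _ := by
          refine Finset.sum_congr rfl fun i _ => Finset.sum_congr rfl fun j _ => ?_
          rw [← lintegral_sub_left_eq_self _ (((i : ℕ) : ℝ) + 1)]
          refine lintegral_congr fun x => ?_
          congr 2 <;> push_cast <;> ring
  refine ne_top_of_le_ne_top ?_ (ENNReal.tsum_le_tsum hle)
  rw [Summable.tsum_finsetSum fun _ _ => ENNReal.summable]
  refine ENNReal.sum_ne_top.2 fun i _ => ?_
  rw [Summable.tsum_finsetSum fun _ _ => ENNReal.summable]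
  refine ENNReal.sum_ne_top.2 fun j _ => ?_
  rw [← (Equiv.addLeft (((j : ℕ) : ℤ) - ((i : ℕ) : ℤ))).tsum_eq] at hQ
  exact hQ

lemma integrable_envelopeProd_of_ne_top {β : ℝ} {g : ℝ → ℝ} (hg : Measurable g) {m : ℕ}
    (h : ∑' ℓ : ℤ, ∫⁻ x, ENNReal.ofReal (envelopeProd β g m ℓ x) ≠ ∞) (ℓ : ℤ) :
    Integrable (envelopeProd β g m ℓ) := by
  refine ⟨?_, ?_⟩
  · have := measurable_kernelEnvelope hg m
    unfold envelopeProd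
    exact Measurable.aestronglyMeasurable (by fun_prop)
  · rw [hasFiniteIntegral_iff_ofReal (.of_forall (envelopeProd_nonneg β g m ℓ))]
    exact (ENNReal.ne_top_of_tsum_ne_top h ℓ).lt_top

lemma summable_integral_envelopeProd_of_ne_top {β : ℝ} {g : ℝ → ℝ} (hg : Measurable g) {m : ℕ}
    (h : ∑' ℓ : ℤ, ∫⁻ x, ENNReal.ofReal (envelopeProd β g m ℓ x) ≠ ∞) :
    Summable fun ℓ : ℤ => ∫ x, envelopeProd β g m ℓ x := by
  refine (ENNReal.summable_toReal h).congr fun ℓ => ?_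
  rw [← ofReal_integral_eq_lintegral_ofReal (integrable_envelopeProd_of_ne_top hg h ℓ)
    (.of_forall (envelopeProd_nonneg β g m ℓ)),
    ENNReal.toReal_ofReal (integral_nonneg (envelopeProd_nonneg β g m ℓ))]

/-- The kernel `x ↦ ∑ u_i g(i - x)` of the linear form `⟨u, Z₀⟩`. -/
noncomputable def formKernel (g : ℝ → ℝ) {m : ℕ} (u : Fin m → ℝ) (x : ℝ) : ℝ :=
  ∑ i : Fin m, u i * g (((i : ℕ) : ℝ) + 1 - x)

lemma measurable_formKernel {g : ℝ → ℝ} (hg : Measurable g) {m : ℕ} (u : Fin m → ℝ) :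
    Measurable (formKernel g u) := by
  unfold formKernel
  fun_prop

lemma formKernel_sub (g : ℝ → ℝ) {m : ℕ} (u v : Fin m → ℝ) (x : ℝ) :
    formKernel g (u - v) x = formKernel g u x - formKernel g v x := by
  simp [formKernel, sub_mul, Finset.sum_sub_distrib]

lemma formKernel_zero (g : ℝ → ℝ) (m : ℕ) (x : ℝ) : formKernel g (0 : Fin m → ℝ) x = 0 := by
  simp [formKernel]

lemma abs_formKernel_rpow_le (g : ℝ → ℝ) {m : ℕ} {u : Fin m → ℝ} {N : ℝ} (hN : ∑ i, |u i| ≤ N)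
    {p : ℝ} (hp : 0 ≤ p) (x : ℝ) :
    |formKernel g u x| ^ p ≤ N ^ p * kernelEnvelope g m x ^ p := by
  have hN0 : 0 ≤ N := (Finset.sum_nonneg fun _ _ => abs_nonneg _).trans hN
  rw [← Real.mul_rpow hN0 (kernelEnvelope_nonneg _ _ _)]
  refine Real.rpow_le_rpow (abs_nonneg _) ?_ hp
  calc |formKernel g u x| ≤ ∑ i : Fin m, |u i * g (((i : ℕ) : ℝ) + 1 - x)| :=
        Finset.abs_sum_le_sum_abs _ _
    _ ≤ ∑ i : Fin m, N * |g (((i : ℕ) : ℝ) + 1 - x)| := by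
        refine Finset.sum_le_sum fun i hi => ?_
        rw [abs_mul]
        gcongr
        exact (Finset.single_le_sum (f := fun i => |u i|) (fun _ _ => abs_nonneg _) hi).trans hN
    _ = N * kernelEnvelope g m x := by rw [kernelEnvelope, Finset.mul_sum]

lemma abs_formKernel_mul_le (g : ℝ → ℝ) {m : ℕ} {u v : Fin m → ℝ} {N δ : ℝ}
    (hu : ∑ i, |u i| ≤ N) (hv : ∑ i, |v i| ≤ δ) {β : ℝ} (hβ : 0 < β) (ℓ : ℤ) (x : ℝ) :
    |formKernel g u x| ^ (β / 2) * |formKernel g v (x - ℓ)| ^ (β / 2)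
      ≤ N ^ (β / 2) * δ ^ (β / 2) * envelopeProd β g m ℓ x := by
  have hβ' : 0 ≤ β / 2 := by positivity
  have h1 := abs_formKernel_rpow_le g hu hβ' x
  have h2 := abs_formKernel_rpow_le g hv hβ' (x - ℓ)
  calc _ ≤ (N ^ (β / 2) * kernelEnvelope g m x ^ (β / 2))
        * (δ ^ (β / 2) * kernelEnvelope g m (x - ℓ) ^ (β / 2)) :=
        mul_le_mul h1 h2 (by positivity) ((by positivity : (0:ℝ) ≤ _).trans h1)
    _ = _ := by
        rw [envelopeProd]
        ring

lemma rpow_half_mul_rpow_half {β : ℝ} (hβ : 0 < β) (x : ℝ) :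
    |x| ^ (β / 2) * |x| ^ (β / 2) = |x| ^ β := by
  rw [← Real.rpow_add_of_nonneg (abs_nonneg x) (by positivity) (by positivity), add_halves]

lemma integrable_abs_formKernel_rpow {β : ℝ} (hβ : 0 < β) {g : ℝ → ℝ} (hg : Measurable g) {m : ℕ}
    (h0 : Integrable (envelopeProd β g m 0)) (u : Fin m → ℝ) :
    Integrable fun x => |formKernel g u x| ^ β := by
  have hm := measurable_formKernel hg u
  refine (h0.const_mul ((∑ i, |u i|) ^ (β / 2) * (∑ i, |u i|) ^ (β / 2))).mono'
    (Measurable.aestronglyMeasurable (by fun_prop)) (.of_forall fun x => ?_)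
  rw [Real.norm_eq_abs, abs_of_nonneg (by positivity), ← rpow_half_mul_rpow_half hβ]
  simpa using abs_formKernel_mul_le g le_rfl le_rfl hβ 0 x (u := u) (v := u)

lemma integrable_abs_formKernel_add_rpow {β : ℝ} (hβ0 : 0 < β) (hβ2 : β < 2) {g : ℝ → ℝ}
    (hg : Measurable g) {m : ℕ} (h0 : Integrable (envelopeProd β g m 0)) {ℓ : ℤ}
    (hℓ : Integrable (envelopeProd β g m ℓ)) (u v : Fin m → ℝ) :
    Integrable fun x => |formKernel g u x + formKernel g v (x - ℓ)| ^ β := by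
  have hmu := measurable_formKernel hg u
  have hmv := measurable_formKernel hg v
  refine (((integrable_abs_formKernel_rpow hβ0 hg h0 u).add
    ((integrable_abs_formKernel_rpow hβ0 hg h0 v).comp_sub_right (ℓ : ℝ))).add
    (hℓ.const_mul (4 * ((∑ i, |u i|) ^ (β / 2) * (∑ i, |v i|) ^ (β / 2))))).mono'
    (Measurable.aestronglyMeasurable (by fun_prop)) (.of_forall fun x => ?_)
  rw [Real.norm_eq_abs, abs_of_nonneg (by positivity)]
  have h1 := (abs_le.1 (abs_second_difference_rpow_le hβ0 hβ2 (formKernel g u x) 0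
    (formKernel g v (x - ℓ)))).2
  have h2 := abs_formKernel_mul_le g le_rfl le_rfl hβ0 ℓ x (u := u) (v := v)
  simp only [zero_add, abs_zero, Real.zero_rpow hβ0.ne', sub_zero] at h1
  simp only [Pi.add_apply]
  linarith

/-- The `β`-energy `∫ |∑ u_i g(i - x)|^β dx` of the linear form `⟨u, Z₀⟩`. -/
noncomputable def formEnergy (β : ℝ) (g : ℝ → ℝ) {m : ℕ} (u : Fin m → ℝ) : ℝ :=
  ∫ x, |formKernel g u x| ^ β

/-- The excess energy of `⟨u, Z₀⟩ + ⟨v, Z_ℓ⟩` over the independent case. -/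
noncomputable def crossEnergy (β : ℝ) (g : ℝ → ℝ) {m : ℕ} (ℓ : ℤ) (u v : Fin m → ℝ) : ℝ :=
  (∫ x, |formKernel g u x + formKernel g v (x - ℓ)| ^ β) - (formEnergy β g u + formEnergy β g v)

lemma formEnergy_nonneg (β : ℝ) (g : ℝ → ℝ) {m : ℕ} (u : Fin m → ℝ) : 0 ≤ formEnergy β g u :=
  integral_nonneg fun _ => Real.rpow_nonneg (abs_nonneg _) _

lemma integral_formKernel_sub_right (β : ℝ) (g : ℝ → ℝ) {m : ℕ} (v : Fin m → ℝ) (t : ℝ) :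
    ∫ x, |formKernel g v (x - t)| ^ β = formEnergy β g v :=
  integral_sub_right_eq_self (fun x => |formKernel g v x| ^ β) t

lemma Udep_eq (β : ℝ) (g : ℝ → ℝ) (m : ℕ) (ℓ : ℤ) (u v : Fin m → ℝ) :
    Udep β g m ℓ u v =
      Real.exp (-((formEnergy β g u + formEnergy β g v) + crossEnergy β g ℓ u v))
        - Real.exp (-(formEnergy β g u + formEnergy β g v)) := by
  have hv : ∀ x : ℝ, ∑ i : Fin m, v i * g (((i : ℕ) : ℝ) + 1 + (ℓ : ℝ) - x)
      = formKernel g v (x - ℓ) := by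
    intro x
    refine Finset.sum_congr rfl fun i _ => ?_
    congr 2
    ring
  have hu : ∀ x : ℝ, ∑ i : Fin m, u i * g (((i : ℕ) : ℝ) + 1 - x) = formKernel g u x :=
    fun _ => rfl
  simp only [Udep, Finset.sum_add_distrib, hv, hu, integral_formKernel_sub_right, crossEnergy]
  rw [add_sub_cancel, neg_add']
  rfl

lemma abs_crossEnergy_sub_le {β : ℝ} (hβ0 : 0 < β) (hβ2 : β < 2) {g : ℝ → ℝ}
    (hg : Measurable g) {m : ℕ} (h0 : Integrable (envelopeProd β g m 0)) {ℓ : ℤ}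
    (hℓ : Integrable (envelopeProd β g m ℓ)) {u v w : Fin m → ℝ} {N : ℝ} (hu : ∑ i, |u i| ≤ N) :
    |crossEnergy β g ℓ u v - crossEnergy β g ℓ u w| ≤
      4 * (N ^ (β / 2) * (∑ i, |v i - w i|) ^ (β / 2)) * ∫ x, envelopeProd β g m ℓ x := by
  have iuv := integrable_abs_formKernel_add_rpow hβ0 hβ2 hg h0 hℓ u v
  have iuw := integrable_abs_formKernel_add_rpow hβ0 hβ2 hg h0 hℓ u w
  have iv := (integrable_abs_formKernel_rpow hβ0 hg h0 v).comp_sub_right (ℓ : ℝ)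
  have iw := (integrable_abs_formKernel_rpow hβ0 hg h0 w).comp_sub_right (ℓ : ℝ)
  have heq : crossEnergy β g ℓ u v - crossEnergy β g ℓ u w =
      ∫ x, (|formKernel g u x + formKernel g v (x - ℓ)| ^ β
        - |formKernel g u x + formKernel g w (x - ℓ)| ^ β
        - (|formKernel g v (x - ℓ)| ^ β - |formKernel g w (x - ℓ)| ^ β)) := by
    rw [integral_sub (f := fun x => |formKernel g u x + formKernel g v (x - ℓ)| ^ β
        - |formKernel g u x + formKernel g w (x - ℓ)| ^ β)
      (g := fun x => |formKernel g v (x - ℓ)| ^ β - |formKernel g w (x - ℓ)| ^ β)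
      (iuv.sub iuw) (iv.sub iw),
      integral_sub iuv iuw, integral_sub iv iw,
      integral_formKernel_sub_right, integral_formKernel_sub_right, crossEnergy, crossEnergy]
    ring
  rw [heq, ← integral_const_mul, ← Real.norm_eq_abs]
  refine norm_integral_le_of_norm_le (hℓ.const_mul _) (.of_forall fun x => ?_)
  have h1 := abs_second_difference_rpow_le hβ0 hβ2 (formKernel g u x) (formKernel g w (x - ℓ))
    (formKernel g v (x - ℓ) - formKernel g w (x - ℓ))
  have h2 := abs_formKernel_mul_le g hu (v := v - w) (δ := ∑ i, |v i - w i|) le_rfl hβ0 ℓ x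
  rw [formKernel_sub] at h2
  rw [add_sub_cancel, add_comm (formKernel g w (x - ℓ)) (formKernel g u x), add_assoc,
    add_sub_cancel] at h1
  rw [Real.norm_eq_abs]
  linarith

lemma abs_crossEnergy_le {β : ℝ} (hβ0 : 0 < β) (hβ2 : β < 2) {g : ℝ → ℝ}
    (hg : Measurable g) {m : ℕ} (h0 : Integrable (envelopeProd β g m 0)) {ℓ : ℤ}
    (hℓ : Integrable (envelopeProd β g m ℓ)) {u v : Fin m → ℝ} {N : ℝ} (hu : ∑ i, |u i| ≤ N)
    (hv : ∑ i, |v i| ≤ N) :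
    |crossEnergy β g ℓ u v| ≤
      4 * (N ^ (β / 2) * N ^ (β / 2)) * ∫ x, envelopeProd β g m ℓ x := by
  have h := abs_crossEnergy_sub_le hβ0 hβ2 hg h0 hℓ (v := v) (w := 0) hu
  have hz : crossEnergy β g ℓ u 0 = 0 := by
    simp [crossEnergy, formEnergy, formKernel_zero, Real.zero_rpow hβ0.ne']
  simp only [hz, sub_zero, Pi.zero_apply] at h
  have hP : 0 ≤ ∫ x, envelopeProd β g m ℓ x := integral_nonneg (envelopeProd_nonneg β g m ℓ)
  have hs : 0 ≤ ∑ i, |v i| := Finset.sum_nonneg fun _ _ => abs_nonneg _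
  have hN0 : 0 ≤ N := hs.trans hv
  exact h.trans (by gcongr)

lemma abs_formEnergy_sub_le {β : ℝ} (hβ0 : 0 < β) (hβ2 : β < 2) {g : ℝ → ℝ}
    (hg : Measurable g) {m : ℕ} (h0 : Integrable (envelopeProd β g m 0)) {v w : Fin m → ℝ} {N : ℝ}
    (hv : ∑ i, |v i| ≤ N) (hw : ∑ i, |w i| ≤ N) :
    |formEnergy β g v - formEnergy β g w| ≤
      2 * (N ^ (β / 2) * (∑ i, |v i - w i|) ^ (β / 2)) * ∫ x, envelopeProd β g m 0 x := by
  rw [formEnergy, formEnergy, ← integral_sub (integrable_abs_formKernel_rpow hβ0 hg h0 v)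
    (integrable_abs_formKernel_rpow hβ0 hg h0 w), ← integral_const_mul, ← Real.norm_eq_abs]
  refine norm_integral_le_of_norm_le (h0.const_mul _) (.of_forall fun x => ?_)
  have h1 := abs_abs_rpow_sub_abs_rpow_le (p := β / 2) (by positivity) (by linarith)
    (formKernel g v x) (formKernel g w x)
  have h2 := abs_formKernel_mul_le g hv (v := v - w) (δ := ∑ i, |v i - w i|) le_rfl hβ0 0 x
  have h3 := abs_formKernel_mul_le g hw (v := v - w) (δ := ∑ i, |v i - w i|) le_rfl hβ0 0 x
  rw [formKernel_sub, Int.cast_zero, sub_zero] at h2 h3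
  rw [Real.norm_eq_abs, ← rpow_half_mul_rpow_half hβ0, ← rpow_half_mul_rpow_half hβ0,
    mul_self_sub_mul_self, abs_mul, abs_of_nonneg (by positivity)]
  calc _ ≤ (|formKernel g v x| ^ (β / 2) + |formKernel g w x| ^ (β / 2))
        * |formKernel g v x - formKernel g w x| ^ (β / 2) := by gcongr
    _ ≤ _ := by linarith

/-- Hölder continuity of the dependence measure in its second argument, with a constant that is
summable over the lags. -/
lemma abs_Udep_sub_le {β : ℝ} (hβ0 : 0 < β) (hβ2 : β < 2) {g : ℝ → ℝ}
    (hg : Measurable g) {m : ℕ} (hint : ∀ ℓ, Integrable (envelopeProd β g m ℓ))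
    (hsum : Summable fun ℓ : ℤ => ∫ x, envelopeProd β g m ℓ x) (ℓ : ℤ) {u v w : Fin m → ℝ} {N : ℝ}
    (hu : ∑ i, |u i| ≤ N) (hv : ∑ i, |v i| ≤ N) (hw : ∑ i, |w i| ≤ N) :
    |Udep β g m ℓ u v - Udep β g m ℓ u w| ≤
      Real.exp (4 * (N ^ (β / 2) * N ^ (β / 2)) * ∑' k : ℤ, ∫ x, envelopeProd β g m k x)
        * (8 * N ^ (β / 2) * (N ^ (β / 2) * N ^ (β / 2)) * (∫ x, envelopeProd β g m 0 x)
          + 4 * N ^ (β / 2))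
        * (∑ i, |v i - w i|) ^ (β / 2) * ∫ x, envelopeProd β g m ℓ x := by
  have hP : ∀ k : ℤ, 0 ≤ ∫ x, envelopeProd β g m k x :=
    fun k => integral_nonneg (envelopeProd_nonneg β g m k)
  have hN0 : 0 ≤ N := (Finset.sum_nonneg fun _ _ => abs_nonneg _).trans hu
  have hle := hsum.le_tsum ℓ fun k _ => hP k
  have hd : 4 * (N ^ (β / 2) * N ^ (β / 2)) * (∫ x, envelopeProd β g m ℓ x) ≤
      4 * (N ^ (β / 2) * N ^ (β / 2)) * ∑' k : ℤ, ∫ x, envelopeProd β g m k x := by gcongr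
  have he : |(formEnergy β g u + formEnergy β g v) - (formEnergy β g u + formEnergy β g w)| ≤
      2 * (N ^ (β / 2) * (∑ i, |v i - w i|) ^ (β / 2)) * ∫ x, envelopeProd β g m 0 x := by
    rw [add_sub_add_left_eq_sub]
    exact abs_formEnergy_sub_le hβ0 hβ2 hg (hint 0) hv hw
  rw [Udep_eq, Udep_eq]
  refine (abs_exp_difference_sub_le
    (add_nonneg (formEnergy_nonneg β g u) (formEnergy_nonneg β g v))
    (add_nonneg (formEnergy_nonneg β g u) (formEnergy_nonneg β g w))
    (abs_crossEnergy_le hβ0 hβ2 hg (hint 0) (hint ℓ) hu hv)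
    ((abs_crossEnergy_le hβ0 hβ2 hg (hint 0) (hint ℓ) hu hw).trans hd) hd he
    (abs_crossEnergy_sub_le hβ0 hβ2 hg (hint 0) (hint ℓ) hu)).trans (le_of_eq ?_)
  ring

/-- The main estimate of Appendix A.1.1 of the paper: for every `T > 0` there is
`C_T > 0` such that `∑_{ℓ∈ℤ} |r_ℓ(u,u) − r_ℓ(u,v)| ≤ C_T ‖u−v‖₁^{β/2}` for all
`u, v ∈ [0,T]^m`, yielding the Hölder continuity of the limiting Gaussian field. -/
theorem stmt17 (β : ℝ) (hβ0 : 0 < β) (hβ2 : β < 2) (m : ℕ) (hm : 1 ≤ m)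
    (g : ℝ → ℝ) (hg_meas : Measurable g) (hg_zero : ∀ x ≤ (0:ℝ), g x = 0)
    (K α κ : ℝ) (hK : 0 < K) (hα : 0 < α) (hκ : -1 / β < κ) (hαβ : 2 < α * β)
    (hbound : ∀ x : ℝ, 0 ≤ x →
      |g x| ≤ K * ((Ico (0:ℝ) 1).indicator (fun y => y ^ κ) x
        + (Ici (1:ℝ)).indicator (fun y => y ^ (-α)) x)) :
    ∀ T > (0:ℝ), ∃ C > (0:ℝ), ∀ u v : Fin m → ℝ,
      (∀ i, u i ∈ Icc (0:ℝ) T) → (∀ i, v i ∈ Icc (0:ℝ) T) →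
      Summable (fun ℓ : ℤ => |rdep β g m ℓ u u - rdep β g m ℓ u v|) ∧
      (∑' ℓ : ℤ, |rdep β g m ℓ u u - rdep β g m ℓ u v|)
        ≤ C * (∑ i : Fin m, |u i - v i|) ^ (β / 2) := by
  intro T hT
  have htop := tsum_lintegral_envelopeProd_ne_top hβ0 hβ2 m hg_meas hg_zero hK hκ hαβ hbound
  have hint := integrable_envelopeProd_of_ne_top hg_meas htop
  have hsum := summable_integral_envelopeProd_of_ne_top hg_meas htop
  have hP : ∀ k : ℤ, 0 ≤ ∫ x, envelopeProd β g m k x :=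
    fun k => integral_nonneg (envelopeProd_nonneg β g m k)
  set N : ℝ := m * T with hN
  have hN0 : 0 ≤ N := by positivity
  set A : ℝ := Real.exp (4 * (N ^ (β / 2) * N ^ (β / 2)) * ∑' k : ℤ, ∫ x, envelopeProd β g m k x)
        * (8 * N ^ (β / 2) * (N ^ (β / 2) * N ^ (β / 2)) * (∫ x, envelopeProd β g m 0 x)
          + 4 * N ^ (β / 2)) with hA
  have hA0 : 0 ≤ A := by
    have := hP 0
    positivity
  have hS0 : 0 ≤ ∑' k : ℤ, ∫ x, envelopeProd β g m k x := tsum_nonneg hP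
  refine ⟨A * (∑' k : ℤ, ∫ x, envelopeProd β g m k x) + 1, by positivity, fun u v hu hv => ?_⟩
  have hnorm : ∀ w : Fin m → ℝ, (∀ i, w i ∈ Icc (0:ℝ) T) → ∑ i, |w i| ≤ N := by
    intro w hw
    calc ∑ i, |w i| ≤ ∑ _i : Fin m, T :=
          Finset.sum_le_sum fun i _ => by rw [abs_of_nonneg (hw i).1]; exact (hw i).2
      _ = N := by simp [hN]
  have hneg : ∀ w : Fin m → ℝ, ∑ i, |w i| ≤ N → ∑ i, |(-w) i| ≤ N := by
    intro w hw
    simpa using hw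
  set δ : ℝ := ∑ i : Fin m, |u i - v i| with hδ
  have hδ0 : 0 ≤ δ := Finset.sum_nonneg fun _ _ => abs_nonneg _
  have hterm : ∀ ℓ : ℤ, |rdep β g m ℓ u u - rdep β g m ℓ u v| ≤
      A * δ ^ (β / 2) * ∫ x, envelopeProd β g m ℓ x := by
    intro ℓ
    have h1 := abs_Udep_sub_le hβ0 hβ2 hg_meas hint hsum ℓ (hnorm u hu) (hnorm u hu) (hnorm v hv)
    have h2 := abs_Udep_sub_le hβ0 hβ2 hg_meas hint hsum ℓ (hnorm u hu) (hneg u (hnorm u hu))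
      (hneg v (hnorm v hv))
    have hδ' : ∑ i, |(-u) i - (-v) i| = δ := by
      refine Finset.sum_congr rfl fun i _ => ?_
      rw [Pi.neg_apply, Pi.neg_apply, neg_sub_neg, abs_sub_comm]
    rw [hδ', ← hA] at h2
    rw [← hA, ← hδ] at h1
    rw [rdep, rdep, abs_le]
    rw [abs_le] at h1 h2
    constructor <;> linarith [h1.1, h1.2, h2.1, h2.2]
  have hmaj := hsum.mul_left (A * δ ^ (β / 2))
  have hs := Summable.of_nonneg_of_le (fun _ => abs_nonneg _) hterm hmaj
  refine ⟨hs, (hs.tsum_le_tsum hterm hmaj).trans ?_⟩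
  rw [tsum_mul_left]
  have : 0 ≤ δ ^ (β / 2) := by positivity
  linarith
end
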